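/- Assume 0 < μ < 1, λ ≥ 0 and λ ≥ δ > −1. Then there exists a constant c > 0 such that for all integers n ≥ 2: ∫_{1/n}^{π/4} |M_n(φ)| (sin φ)^{2λ} dφ ≥ c n^{−μ} · L_n, where L_n = log n if λ = δ and L_n = 1 if −1 < δ < λ. -/

import Mathlib

open MeasureTheory Finset Real intervalIntegral

/-- The oscillatory integral
`M_n(φ) = ∫_φ^{π-φ} (cos²φ - cos²θ)^{μ-1} (sin(θ/2))^{-a} (cos(θ/2))^{-b} cos(Nθ+τ) dθ`
with `a = λ+μ+δ`, `b = λ+μ-1`, `N = n+(a+b)/2+1`, `τ = -π(a+1)/2`. -/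
noncomputable def Mosc (lam mu δ : ℝ) (n : ℕ) (φ : ℝ) : ℝ :=
  ∫ θ in φ..(Real.pi - φ),
    (Real.cos φ ^ 2 - Real.cos θ ^ 2) ^ (mu - 1) *
      (Real.sin (θ / 2)) ^ (-(lam + mu + δ)) * (Real.cos (θ / 2)) ^ (-(lam + mu - 1)) *
      Real.cos (((n : ℝ) + ((lam + mu + δ) + (lam + mu - 1)) / 2 + 1) * θ +
        (-(Real.pi * ((lam + mu + δ) + 1) / 2)))

/-- The Laplace-type representation of the tail `∫_t^∞ s^(μ-1) e^{is} ds`, up to the factor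
`i e^{it}`. -/
noncomputable def laplaceTail (mu t : ℝ) : ℂ :=
  ∫ y in Set.Ioi (0 : ℝ), ((t : ℂ) + y * Complex.I) ^ ((mu - 1 : ℝ) : ℂ) * (Real.exp (-y) : ℂ)

/-- The oscillatory tail `∫_t^∞ s^(μ-1) e^{is} ds`, obtained by rotating the contour. -/
noncomputable def oscTail (mu t : ℝ) : ℂ :=
  Complex.I * Complex.exp (t * Complex.I) * laplaceTail mu t

lemma add_mul_I_mem_slitPlane_of_pos {t y : ℝ} (ht : 0 < t) :
    (t : ℂ) + y * Complex.I ∈ Complex.slitPlane := by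
  left; simpa using ht

lemma add_mul_I_mem_slitPlane {t y : ℝ} (hy : 0 < y) :
    (t : ℂ) + y * Complex.I ∈ Complex.slitPlane := by
  right; simpa using hy.ne'

lemma le_norm_add_mul_I {t y : ℝ} (ht : 0 ≤ t) : t ≤ ‖(t : ℂ) + y * Complex.I‖ := by
  have := Complex.abs_re_le_norm ((t : ℂ) + y * Complex.I)
  simpa [abs_of_nonneg ht] using this

lemma le_norm_add_mul_I' {t y : ℝ} (hy : 0 ≤ y) : y ≤ ‖(t : ℂ) + y * Complex.I‖ := by
  have := Complex.abs_im_le_norm ((t : ℂ) + y * Complex.I)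
  simpa [abs_of_nonneg hy] using this

lemma aestronglyMeasurable_laplace_kernel (r t : ℝ) :
    AEStronglyMeasurable (fun y : ℝ => ((t : ℂ) + y * Complex.I) ^ (r : ℂ) *
      (Real.exp (-y) : ℂ)) (volume.restrict (Set.Ioi 0)) := by
  refine ContinuousOn.aestronglyMeasurable ?_ measurableSet_Ioi
  refine ContinuousOn.mul ?_ (by fun_prop)
  intro y hy
  exact ((by fun_prop : Continuous fun y : ℝ => (t : ℂ) + y * Complex.I).continuousWithinAt).cpow
    continuousWithinAt_const (add_mul_I_mem_slitPlane hy)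

lemma norm_laplace_kernel_le {mu t y : ℝ} (hmu2 : mu < 1) (hy : 0 < y) :
    ‖((t : ℂ) + y * Complex.I) ^ ((mu - 1 : ℝ) : ℂ) * (Real.exp (-y) : ℂ)‖ ≤
      Real.exp (-y) * y ^ (mu - 1) := by
  rw [norm_mul, Complex.norm_cpow_real, Complex.norm_real, Real.norm_eq_abs, Real.abs_exp, mul_comm]
  exact mul_le_mul_of_nonneg_left
    (Real.rpow_le_rpow_of_nonpos hy (le_norm_add_mul_I' hy.le) (by linarith)) (Real.exp_pos _).le

lemma integrableOn_laplace_kernel {mu : ℝ} (hmu1 : 0 < mu) (hmu2 : mu < 1) (t : ℝ) :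
    IntegrableOn (fun y : ℝ => ((t : ℂ) + y * Complex.I) ^ ((mu - 1 : ℝ) : ℂ) *
      (Real.exp (-y) : ℂ)) (Set.Ioi 0) := by
  refine Integrable.mono' (Real.GammaIntegral_convergent hmu1)
    (aestronglyMeasurable_laplace_kernel _ _) ?_
  exact (ae_restrict_iff' measurableSet_Ioi).2 (Filter.Eventually.of_forall fun y hy =>
    norm_laplace_kernel_le hmu2 hy)

lemma continuous_laplaceTail {mu : ℝ} (hmu1 : 0 < mu) (hmu2 : mu < 1) :
    Continuous (laplaceTail mu) := by
  rw [← continuousOn_univ]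
  refine continuousOn_of_dominated (fun t _ => aestronglyMeasurable_laplace_kernel _ _)
    (fun t _ => (ae_restrict_iff' measurableSet_Ioi).2 (Filter.Eventually.of_forall fun y hy =>
      norm_laplace_kernel_le hmu2 hy)) (Real.GammaIntegral_convergent hmu1) ?_
  refine (ae_restrict_iff' measurableSet_Ioi).2 (Filter.Eventually.of_forall fun y hy => ?_)
  intro t _
  refine ContinuousWithinAt.mul (ContinuousWithinAt.cpow ?_ continuousWithinAt_const
    (add_mul_I_mem_slitPlane hy)) continuousWithinAt_const
  exact (by fun_prop : Continuous fun t : ℝ => (t : ℂ) + y * Complex.I).continuousWithinAt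

lemma laplaceTail_zero_ne_zero {mu : ℝ} (hmu1 : 0 < mu) : laplaceTail mu 0 ≠ 0 := by
  have h : laplaceTail mu 0 = Complex.I ^ ((mu - 1 : ℝ) : ℂ) * (Real.Gamma mu : ℂ) := by
    rw [Real.Gamma_eq_integral hmu1, ← integral_complex_ofReal, ← MeasureTheory.integral_const_mul]
    refine setIntegral_congr_fun measurableSet_Ioi fun y hy => ?_
    have hy' : (0 : ℝ) < y := hy
    have hyc : (y : ℂ) ≠ 0 := by exact_mod_cast hy'.ne'
    simp only [Complex.ofReal_zero, zero_add]
    rw [Complex.cpow_def_of_ne_zero (mul_ne_zero hyc Complex.I_ne_zero),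
      Complex.log_ofReal_mul hy' Complex.I_ne_zero, add_mul, Complex.exp_add,
      ← Complex.cpow_def_of_ne_zero Complex.I_ne_zero, Complex.ofReal_log hy'.le,
      ← Complex.cpow_def_of_ne_zero hyc, ← Complex.ofReal_cpow hy'.le]
    push_cast
    ring
  rw [h]
  refine mul_ne_zero ?_ (by exact_mod_cast (Real.Gamma_pos_of_pos hmu1).ne')
  simp [Complex.cpow_def_of_ne_zero Complex.I_ne_zero]

lemma oscTail_zero_ne_zero {mu : ℝ} (hmu1 : 0 < mu) : oscTail mu 0 ≠ 0 := by
  simp [oscTail, laplaceTail_zero_ne_zero hmu1]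

lemma continuous_oscTail {mu : ℝ} (hmu1 : 0 < mu) (hmu2 : mu < 1) : Continuous (oscTail mu) := by
  have := continuous_laplaceTail hmu1 hmu2
  unfold oscTail
  fun_prop

lemma norm_oscTail_le {mu t : ℝ} (hmu2 : mu < 1) (ht : 0 < t) :
    ‖oscTail mu t‖ ≤ t ^ (mu - 1) := by
  have h1 : ‖oscTail mu t‖ = ‖laplaceTail mu t‖ := by
    rw [oscTail, norm_mul, norm_mul, Complex.norm_exp_ofReal_mul_I, Complex.norm_I, one_mul,
      one_mul]
  rw [h1, laplaceTail]
  refine (MeasureTheory.norm_integral_le_of_norm_le (g := fun y => t ^ (mu - 1) * Real.exp (-y))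
    ((integrableOn_exp_neg_Ioi 0).const_mul _) ?_).trans ?_
  · refine (ae_restrict_iff' measurableSet_Ioi).2 (Filter.Eventually.of_forall fun y hy => ?_)
    rw [norm_mul, Complex.norm_cpow_real, Complex.norm_real, Real.norm_eq_abs, Real.abs_exp]
    exact mul_le_mul_of_nonneg_right
      (Real.rpow_le_rpow_of_nonpos ht (le_norm_add_mul_I ht.le) (by linarith)) (Real.exp_pos _).le
  · rw [MeasureTheory.integral_const_mul, integral_exp_neg_Ioi_zero, mul_one]

lemma integral_laplace_kernel_deriv {mu t : ℝ} (hmu1 : 0 < mu) (hmu2 : mu < 1) (ht : 0 < t)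
    (hInt : IntegrableOn (fun y : ℝ => ((mu - 1 : ℝ) : ℂ) *
      ((t : ℂ) + y * Complex.I) ^ (((mu - 1 : ℝ) : ℂ) - 1) * (Real.exp (-y) : ℂ)) (Set.Ioi 0)) :
    Complex.I * (∫ y in Set.Ioi (0 : ℝ), ((mu - 1 : ℝ) : ℂ) *
      ((t : ℂ) + y * Complex.I) ^ (((mu - 1 : ℝ) : ℂ) - 1) * (Real.exp (-y) : ℂ)) =
      laplaceTail mu t - ((t ^ (mu - 1) : ℝ) : ℂ) := by
  have hW := integrableOn_laplace_kernel hmu1 hmu2 t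
  have hexp (y : ℝ) : HasDerivAt (fun y : ℝ => (Real.exp (-y) : ℂ)) (-(Real.exp (-y) : ℂ)) y := by
    have := ((Real.hasDerivAt_exp (-y)).comp y (hasDerivAt_neg y)).ofReal_comp
    simpa using this
  have hlin (y : ℝ) : HasDerivAt (fun y : ℝ => (t : ℂ) + y * Complex.I) Complex.I y := by
    have := ((hasDerivAt_id y).ofReal_comp.mul_const Complex.I).const_add (t : ℂ)
    simpa using this
  have hder (y : ℝ) : HasDerivAt
      (fun y : ℝ => ((t : ℂ) + y * Complex.I) ^ ((mu - 1 : ℝ) : ℂ) * (Real.exp (-y) : ℂ))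
      (Complex.I * (((mu - 1 : ℝ) : ℂ) *
      ((t : ℂ) + y * Complex.I) ^ (((mu - 1 : ℝ) : ℂ) - 1) * (Real.exp (-y) : ℂ)) -
      ((t : ℂ) + y * Complex.I) ^ ((mu - 1 : ℝ) : ℂ) * (Real.exp (-y) : ℂ)) y := by
    have h2 : HasDerivAt (fun z : ℂ => z ^ ((mu - 1 : ℝ) : ℂ)) _ ((t : ℂ) + y * Complex.I) :=
      (hasDerivAt_id _).cpow_const (add_mul_I_mem_slitPlane_of_pos ht)
    have h3 := (h2.comp_of_eq y (hlin y) rfl).mul (hexp y)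
    refine h3.congr_deriv ?_
    simp only [id, Function.comp]
    ring
  have key := integral_Ioi_of_hasDerivAt_of_tendsto (a := 0) (m := 0)
    (hder 0).continuousAt.continuousWithinAt (fun y _ => hder y)
    ((hInt.const_mul Complex.I).sub hW) ?_
  · rw [integral_sub (hInt.const_mul Complex.I) hW, MeasureTheory.integral_const_mul] at key
    rw [laplaceTail, ← sub_eq_zero]
    rw [← sub_eq_zero] at key
    rw [← key, Complex.ofReal_cpow ht.le]
    simp
    ring
  · rw [tendsto_zero_iff_norm_tendsto_zero]
    have h0 : Filter.Tendsto (fun y : ℝ => t ^ (mu - 1) * Real.exp (-y)) Filter.atTop (nhds 0) := by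
      simpa using (Real.tendsto_exp_neg_atTop_nhds_zero).const_mul (t ^ (mu - 1))
    refine squeeze_zero (fun _ => norm_nonneg _) (fun y => ?_) h0
    rw [norm_mul, Complex.norm_cpow_real, Complex.norm_real, Real.norm_eq_abs, Real.abs_exp]
    exact mul_le_mul_of_nonneg_right
      (Real.rpow_le_rpow_of_nonpos ht (le_norm_add_mul_I ht.le) (by linarith)) (Real.exp_pos _).le

lemma hasDerivAt_laplaceTail {mu t : ℝ} (hmu1 : 0 < mu) (hmu2 : mu < 1) (ht : 0 < t) :
    HasDerivAt (laplaceTail mu)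
      (Complex.I * ((t ^ (mu - 1) : ℝ) : ℂ) - Complex.I * laplaceTail mu t) t := by
  have hlin (x y : ℝ) : HasDerivAt (fun x : ℝ => (x : ℂ) + y * Complex.I) 1 x := by
    have := (hasDerivAt_id x).ofReal_comp.add_const (y * Complex.I)
    simpa using this
  have hs : Set.Ioi (t / 2) ∈ nhds t := Ioi_mem_nhds (by linarith)
  have hmeas : AEStronglyMeasurable (fun y : ℝ => ((mu - 1 : ℝ) : ℂ) *
      ((t : ℂ) + y * Complex.I) ^ (((mu - 1 : ℝ) : ℂ) - 1) * (Real.exp (-y) : ℂ))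
      (volume.restrict (Set.Ioi (0 : ℝ))) := by
    have := (aestronglyMeasurable_laplace_kernel (mu - 1 - 1) t).const_mul ((mu - 1 : ℝ) : ℂ)
    refine this.congr (Filter.Eventually.of_forall fun y => ?_)
    push_cast
    ring
  have hbound : ∀ᵐ y ∂(volume.restrict (Set.Ioi (0 : ℝ))), ∀ x ∈ Set.Ioi (t / 2),
      ‖((mu - 1 : ℝ) : ℂ) * ((x : ℂ) + y * Complex.I) ^ (((mu - 1 : ℝ) : ℂ) - 1) *
        (Real.exp (-y) : ℂ)‖ ≤ |mu - 1| * (t / 2) ^ (mu - 1 - 1) * Real.exp (-y) := by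
    refine (ae_restrict_iff' measurableSet_Ioi).2 (Filter.Eventually.of_forall fun y hy => ?_)
    intro x hx
    have hx' : t / 2 < x := hx
    have h1 : (((mu - 1 : ℝ) : ℂ) - 1) = ((mu - 1 - 1 : ℝ) : ℂ) := by push_cast; ring
    rw [norm_mul, norm_mul, h1, Complex.norm_cpow_real, Complex.norm_real, Complex.norm_real,
      Real.norm_eq_abs, Real.norm_eq_abs, Real.abs_exp]
    have ht2 : 0 < t / 2 := by linarith
    have hexp : mu - 1 - 1 ≤ 0 := by linarith
    exact mul_le_mul_of_nonneg_right (mul_le_mul_of_nonneg_left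
      (Real.rpow_le_rpow_of_nonpos ht2 (hx'.le.trans (le_norm_add_mul_I (ht2.le.trans hx'.le)))
        hexp) (abs_nonneg _)) (Real.exp_pos _).le
  have hderiv : ∀ᵐ y ∂(volume.restrict (Set.Ioi (0 : ℝ))), ∀ x ∈ Set.Ioi (t / 2),
      HasDerivAt (fun x : ℝ => ((x : ℂ) + y * Complex.I) ^ ((mu - 1 : ℝ) : ℂ) *
        (Real.exp (-y) : ℂ)) (((mu - 1 : ℝ) : ℂ) *
        ((x : ℂ) + y * Complex.I) ^ (((mu - 1 : ℝ) : ℂ) - 1) * (Real.exp (-y) : ℂ)) x := by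
    refine (ae_restrict_iff' measurableSet_Ioi).2 (Filter.Eventually.of_forall fun y hy => ?_)
    intro x _
    have h2 : HasDerivAt (fun z : ℂ => z ^ ((mu - 1 : ℝ) : ℂ)) _ ((x : ℂ) + y * Complex.I) :=
      (hasDerivAt_id _).cpow_const (add_mul_I_mem_slitPlane hy)
    have h3 := (h2.comp_of_eq x (hlin x y) rfl).mul_const (Real.exp (-y) : ℂ)
    refine h3.congr_deriv ?_
    simp
  obtain ⟨hInt, hd⟩ := _root_.hasDerivAt_integral_of_dominated_loc_of_deriv_le
    (F := fun (t y : ℝ) => ((t : ℂ) + y * Complex.I) ^ ((mu - 1 : ℝ) : ℂ) * (Real.exp (-y) : ℂ)) hs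
    (Filter.Eventually.of_forall fun x => aestronglyMeasurable_laplace_kernel _ _)
    (integrableOn_laplace_kernel hmu1 hmu2 t) hmeas hbound
    ((integrableOn_exp_neg_Ioi 0).const_mul _) hderiv
  refine hd.congr_deriv ?_
  linear_combination (-Complex.I) * integral_laplace_kernel_deriv hmu1 hmu2 ht hInt +
    (∫ y in Set.Ioi (0 : ℝ), ((mu - 1 : ℝ) : ℂ) *
      ((t : ℂ) + y * Complex.I) ^ (((mu - 1 : ℝ) : ℂ) - 1) * (Real.exp (-y) : ℂ)) *
        Complex.I_mul_I

lemma hasDerivAt_oscTail {mu t : ℝ} (hmu1 : 0 < mu) (hmu2 : mu < 1) (ht : 0 < t) :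
    HasDerivAt (oscTail mu)
      (-(((t ^ (mu - 1) : ℝ) : ℂ) * Complex.exp (t * Complex.I))) t := by
  have h1 : HasDerivAt (fun t : ℝ => (t : ℂ) * Complex.I) Complex.I t := by
    simpa using (hasDerivAt_id t).ofReal_comp.mul_const Complex.I
  have h2 := (h1.cexp.const_mul Complex.I).mul (hasDerivAt_laplaceTail hmu1 hmu2 ht)
  refine h2.congr_deriv ?_
  linear_combination (((t ^ (mu - 1) : ℝ) : ℂ) * Complex.exp (t * Complex.I)) *
    Complex.I_mul_I

lemma intervalIntegrable_ofReal {f : ℝ → ℝ} {a b : ℝ} (hf : IntervalIntegrable f volume a b) :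
    IntervalIntegrable (fun t => (f t : ℂ)) volume a b :=
  ⟨hf.1.ofReal, hf.2.ofReal⟩

lemma intervalIntegrable_add_rpow_mul_rpow {mu φ T : ℝ} (hmu1 : 0 < mu) (hφ : 0 < φ)
    (hT : 0 ≤ T) (s : ℝ) :
    IntervalIntegrable (fun t => (φ + t) ^ s * t ^ (mu - 1)) volume 0 T := by
  refine IntervalIntegrable.continuousOn_mul (intervalIntegrable_rpow' (by linarith)) ?_
  intro t ht
  rw [Set.uIcc_of_le hT] at ht
  exact (ContinuousAt.rpow_const (by fun_prop) (Or.inl (by linarith [ht.1]))).continuousWithinAt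

lemma integral_add_rpow_mul_rpow_le {mu φ T e : ℝ} (hmu1 : 0 < mu) (hφ : 0 < φ) (hT : φ ≤ T)
    (he : mu < e) :
    ∫ t in (0 : ℝ)..T, (φ + t) ^ (-e) * t ^ (mu - 1) ≤
      (1 / mu + 1 / (e - mu)) * φ ^ (mu - e) := by
  have hInt (A : ℝ) (hA : 0 ≤ A) := intervalIntegrable_add_rpow_mul_rpow hmu1 hφ hA (-e)
  have hi1 := hInt φ hφ.le
  have hi2 : IntervalIntegrable (fun t => (φ + t) ^ (-e) * t ^ (mu - 1)) volume φ T :=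
    hi1.symm.trans (hInt T (hφ.le.trans hT))
  have h0 : (0 : ℝ) ∉ Set.uIcc φ T := by
    rw [Set.uIcc_of_le hT]
    exact fun h => absurd h.1 (not_le.2 hφ)
  rw [← integral_add_adjacent_intervals hi1 hi2, add_mul]
  refine add_le_add ?_ ?_
  · have h1 : ∫ t in (0 : ℝ)..φ, φ ^ (-e) * t ^ (mu - 1) = 1 / mu * φ ^ (mu - e) := by
      rw [intervalIntegral.integral_const_mul, integral_rpow (Or.inl (by linarith))]
      rw [sub_add_cancel, Real.zero_rpow hmu1.ne', sub_eq_add_neg mu e, Real.rpow_add hφ]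
      ring
    rw [← h1]
    refine integral_mono_on hφ.le hi1
      ((intervalIntegrable_rpow' (by linarith)).const_mul _) fun t ht => ?_
    exact mul_le_mul_of_nonneg_right
      (Real.rpow_le_rpow_of_nonpos hφ (by linarith [ht.1]) (by linarith))
      (Real.rpow_nonneg ht.1 _)
  · have h1 : ∫ t in φ..T, t ^ (mu - e - 1) ≤ 1 / (e - mu) * φ ^ (mu - e) := by
      rw [integral_rpow (Or.inr ⟨by linarith, h0⟩), sub_add_cancel]
      have h2 : (T ^ (mu - e) - φ ^ (mu - e)) / (mu - e) =
          (φ ^ (mu - e) - T ^ (mu - e)) / (e - mu) := by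
        rw [← neg_sub e mu, div_neg, ← neg_div, neg_sub]
      rw [h2, one_div_mul_eq_div]
      have := Real.rpow_nonneg (hφ.le.trans hT) (mu - e)
      have := sub_pos.2 he
      gcongr
      linarith
    refine le_trans (integral_mono_on hT hi2 (intervalIntegrable_rpow (Or.inr h0)) ?_) h1
    intro t ht
    have ht0 : 0 < t := hφ.trans_le ht.1
    have h3 : t ^ (mu - e - 1) = t ^ (-e) * t ^ (mu - 1) := by
      rw [← Real.rpow_add ht0]; ring_nf
    rw [h3]
    exact mul_le_mul_of_nonneg_right
      (Real.rpow_le_rpow_of_nonpos ht0 (by linarith) (by linarith))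
      (Real.rpow_nonneg ht0.le _)

/-- First term of the endpoint expansion of an oscillatory integral with an algebraic singularity
at the left endpoint. -/
lemma norm_integral_rpow_mul_exp_sub_le {mu φ T e K N : ℝ} {q : ℝ → ℝ} (hmu1 : 0 < mu)
    (hmu2 : mu < 1) (hφ : 0 < φ) (hT : φ ≤ T) (he : mu < e) (hN : 0 < N) (hK : 0 ≤ K)
    (hq : ContinuousOn q (Set.Icc 0 T)) (hd : ∀ t ∈ Set.Ioo 0 T, DifferentiableAt ℝ q t)
    (hb : ∀ t ∈ Set.Ioo 0 T, |deriv q t| ≤ K * (φ + t) ^ (-e)) :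
    ‖(∫ t in (0 : ℝ)..T, ((t ^ (mu - 1) * q t : ℝ) : ℂ) * Complex.exp ((N * t : ℝ) * Complex.I)) -
      ((q 0 * N ^ (-mu) : ℝ) : ℂ) * oscTail mu 0‖ ≤
      N⁻¹ * (|q T| * T ^ (mu - 1) + K * ((1 / mu + 1 / (e - mu)) * φ ^ (mu - e))) := by
  have hT0 : 0 < T := hφ.trans_le hT
  set E : ℝ → ℂ := fun t => ((N ^ (-mu) : ℝ) : ℂ) * oscTail mu (N * t) with hE
  have hEc : Continuous E := by
    have := continuous_oscTail hmu1 hmu2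
    fun_prop
  have hEn (t : ℝ) (ht : 0 < t) : ‖E t‖ ≤ N⁻¹ * t ^ (mu - 1) := by
    have h1 := norm_oscTail_le hmu2 (mul_pos hN ht)
    have h2 : N⁻¹ * t ^ (mu - 1) = N ^ (-mu) * (N * t) ^ (mu - 1) := by
      rw [Real.mul_rpow hN.le ht.le, ← mul_assoc, ← Real.rpow_add hN, ← Real.rpow_neg_one]
      ring_nf
    rw [h2, hE]
    simp only [norm_mul, Complex.norm_real, Real.norm_eq_abs]
    rw [abs_of_nonneg (Real.rpow_nonneg hN.le _)]
    exact mul_le_mul_of_nonneg_left h1 (Real.rpow_nonneg hN.le _)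
  have hEd (t : ℝ) (ht : 0 < t) : HasDerivAt E
      (-(((t ^ (mu - 1) : ℝ) : ℂ) * Complex.exp ((N * t : ℝ) * Complex.I))) t := by
    have h1 := (hasDerivAt_oscTail hmu1 hmu2 (mul_pos hN ht)).scomp t
      ((hasDerivAt_id t).const_mul N)
    refine (h1.const_mul ((N ^ (-mu) : ℝ) : ℂ)).congr_deriv ?_
    have h2 : N ^ (-mu) * N * (N * t) ^ (mu - 1) = t ^ (mu - 1) := by
      rw [Real.mul_rpow hN.le ht.le, ← mul_assoc, ← Real.rpow_add_one hN.ne', ← Real.rpow_add hN]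
      ring_nf
      simp
    rw [← h2]
    simp only [Complex.real_smul, mul_one]
    push_cast
    ring
  have hker : IntervalIntegrable
      (fun t : ℝ => ((t ^ (mu - 1) : ℝ) : ℂ) * Complex.exp ((N * t : ℝ) * Complex.I))
      volume 0 T := by
    have h1 : IntervalIntegrable (fun t : ℝ => ((t ^ (mu - 1) : ℝ) : ℂ)) volume 0 T :=
      intervalIntegrable_ofReal (intervalIntegrable_rpow' (by linarith))
    exact h1.mul_continuousOn (by fun_prop)
  have hKint : IntervalIntegrable (fun t => K * (φ + t) ^ (-e)) volume 0 T := by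
    refine ContinuousOn.intervalIntegrable fun t ht => ?_
    rw [Set.uIcc_of_le hT0.le] at ht
    exact (continuousAt_const.mul (ContinuousAt.rpow_const (by fun_prop)
      (Or.inl (by linarith [ht.1])))).continuousWithinAt
  have hae : ∀ᵐ t ∂volume, t ∈ Set.Ioc 0 T → t ∈ Set.Ioo 0 T := by
    have : ∀ᵐ t ∂(volume : Measure ℝ), t ≠ T := by simp [ae_iff]
    filter_upwards [this] with t ht h
    exact ⟨h.1, lt_of_le_of_ne h.2 ht⟩
  have hq'int : IntervalIntegrable (fun t => ((deriv q t : ℝ) : ℂ)) volume 0 T := by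
    refine intervalIntegrable_ofReal (hKint.mono_fun'
      (stronglyMeasurable_deriv q).aestronglyMeasurable ?_)
    rw [Set.uIoc_of_le hT0.le]
    filter_upwards [ae_restrict_mem measurableSet_Ioc, ae_restrict_of_ae hae] with t ht1 ht2
    exact hb t (ht2 ht1)
  have hIoo : Set.Ioo (min 0 T) (max 0 T) = Set.Ioo 0 T := by
    rw [min_eq_left hT0.le, max_eq_right hT0.le]
  have ibp := integral_mul_deriv_eq_deriv_mul_of_hasDeriv_right (a := 0) (b := T)
    (u := fun t => ((q t : ℝ) : ℂ)) (v := E) (u' := fun t => ((deriv q t : ℝ) : ℂ))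
    (v' := fun t => -(((t ^ (mu - 1) : ℝ) : ℂ) * Complex.exp ((N * t : ℝ) * Complex.I)))
    (by rw [Set.uIcc_of_le hT0.le]; exact Complex.continuous_ofReal.comp_continuousOn hq)
    hEc.continuousOn
    (by rw [hIoo]; exact fun t ht => (hd t ht).hasDerivAt.ofReal_comp.hasDerivWithinAt)
    (by rw [hIoo]; exact fun t ht => (hEd t ht.1).hasDerivWithinAt)
    hq'int hker.neg
  have hlhs : (∫ t in (0 : ℝ)..T, ((t ^ (mu - 1) * q t : ℝ) : ℂ) *
      Complex.exp ((N * t : ℝ) * Complex.I)) - ((q 0 * N ^ (-mu) : ℝ) : ℂ) * oscTail mu 0 =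
      -((q T : ℂ) * E T) + ∫ t in (0 : ℝ)..T, ((deriv q t : ℝ) : ℂ) * E t := by
    have h1 : (∫ t in (0 : ℝ)..T, ((t ^ (mu - 1) * q t : ℝ) : ℂ) *
      Complex.exp ((N * t : ℝ) * Complex.I)) = -∫ t in (0 : ℝ)..T, ((q t : ℝ) : ℂ) *
        -(((t ^ (mu - 1) : ℝ) : ℂ) * Complex.exp ((N * t : ℝ) * Complex.I)) := by
      rw [← intervalIntegral.integral_neg]
      refine integral_congr fun t _ => ?_
      push_cast
      ring
    rw [h1, ibp]
    simp only [hE, mul_zero]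
    push_cast
    ring
  rw [hlhs]
  refine (norm_add_le _ _).trans ?_
  rw [mul_add]
  refine add_le_add ?_ ?_
  · rw [norm_neg, norm_mul, Complex.norm_real, Real.norm_eq_abs]
    calc |q T| * ‖E T‖ ≤ |q T| * (N⁻¹ * T ^ (mu - 1)) :=
          mul_le_mul_of_nonneg_left (hEn T hT0) (abs_nonneg _)
      _ = _ := by ring
  · have hInt := intervalIntegrable_add_rpow_mul_rpow hmu1 hφ hT0.le (-e)
    refine (intervalIntegral.norm_integral_le_of_norm_le
      (g := fun t => N⁻¹ * (K * ((φ + t) ^ (-e) * t ^ (mu - 1)))) hT0.le ?_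
      ((hInt.const_mul _).const_mul _)).trans ?_
    · filter_upwards [hae] with t ht1 ht2
      rw [norm_mul, Complex.norm_real, Real.norm_eq_abs]
      calc |deriv q t| * ‖E t‖ ≤ (K * (φ + t) ^ (-e)) * (N⁻¹ * t ^ (mu - 1)) :=
            mul_le_mul (hb t (ht1 ht2)) (hEn t ht2.1) (norm_nonneg _)
              (mul_nonneg hK (Real.rpow_nonneg (by linarith [ht2.1]) _))
        _ = _ := by ring
    · rw [intervalIntegral.integral_const_mul, intervalIntegral.integral_const_mul]
      have := integral_add_rpow_mul_rpow_le hmu1 hφ hT he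
      gcongr

lemma exists_rpow_compare (s : ℝ) {c₁ c₂ : ℝ} (h1 : 0 < c₁) (h2 : 0 < c₂) :
    ∃ C : ℝ, 0 < C ∧ ∀ x y : ℝ, 0 < y → c₁ * y ≤ x → x ≤ c₂ * y →
      x ^ s ≤ C * y ^ s ∧ y ^ s ≤ C * x ^ s := by
  have hp1 (r : ℝ) : 0 < c₁ ^ r := Real.rpow_pos_of_pos h1 r
  have hp2 (r : ℝ) : 0 < c₂ ^ r := Real.rpow_pos_of_pos h2 r
  have key (r w : ℝ) (hw1 : c₁ ≤ w) (hw2 : w ≤ c₂) : w ^ r ≤ c₁ ^ r + c₂ ^ r := by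
    have hw : 0 < w := h1.trans_le hw1
    rcases le_total 0 r with hr | hr
    · linarith [Real.rpow_le_rpow hw.le hw2 hr, hp1 r]
    · linarith [Real.rpow_le_rpow_of_nonpos h1 hw1 hr, hp2 r]
  refine ⟨(c₁ ^ s + c₂ ^ s) + (c₁ ^ (-s) + c₂ ^ (-s)), ?_, fun x y hy hx1 hx2 => ?_⟩
  · linarith [hp1 s, hp2 s, hp1 (-s), hp2 (-s)]
  have hx : 0 < x := (mul_pos h1 hy).trans_le hx1
  have hw1 : c₁ ≤ x / y := (le_div_iff₀ hy).2 hx1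
  have hw2 : x / y ≤ c₂ := (div_le_iff₀ hy).2 hx2
  have hxs : x ^ s = (x / y) ^ s * y ^ s := by
    rw [← Real.mul_rpow (div_pos hx hy).le hy.le, div_mul_cancel₀ _ hy.ne']
  have hys : y ^ s = (x / y) ^ (-s) * x ^ s := by
    rw [Real.rpow_neg (div_pos hx hy).le, ← Real.inv_rpow (div_pos hx hy).le,
      ← Real.mul_rpow (inv_pos.2 (div_pos hx hy)).le hx.le, inv_div, div_mul_cancel₀ _ hx.ne']
  constructor
  · rw [hxs]
    refine mul_le_mul_of_nonneg_right ?_ (Real.rpow_nonneg hy.le _)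
    linarith [key s _ hw1 hw2, hp1 (-s), hp2 (-s)]
  · rw [hys]
    refine mul_le_mul_of_nonneg_right ?_ (Real.rpow_nonneg hx.le _)
    linarith [key (-s) _ hw1 hw2, hp1 s, hp2 s]

/-- `f` is positive at `t` and its logarithmic derivative there is bounded by `M`. -/
def LogDerivBound (f : ℝ → ℝ) (M t : ℝ) : Prop :=
  0 < f t ∧ ∃ d, HasDerivAt f d t ∧ |d| ≤ M * f t

lemma LogDerivBound.mul {f g : ℝ → ℝ} {M₁ M₂ t : ℝ} (hf : LogDerivBound f M₁ t)
    (hg : LogDerivBound g M₂ t) : LogDerivBound (fun t => f t * g t) (M₁ + M₂) t := by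
  obtain ⟨hf0, d, hd, hdb⟩ := hf
  obtain ⟨hg0, d', hd', hdb'⟩ := hg
  refine ⟨mul_pos hf0 hg0, _, hd.mul hd', ?_⟩
  calc |d * g t + f t * d'| ≤ |d| * g t + f t * |d'| := by
        refine (abs_add_le _ _).trans ?_
        rw [abs_mul, abs_mul, abs_of_pos hf0, abs_of_pos hg0]
    _ ≤ (M₁ * f t) * g t + f t * (M₂ * g t) := by gcongr
    _ = _ := by ring

lemma LogDerivBound.rpow {f : ℝ → ℝ} {M t : ℝ} (hf : LogDerivBound f M t) (s : ℝ) :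
    LogDerivBound (fun t => f t ^ s) (|s| * M) t := by
  obtain ⟨hf0, d, hd, hdb⟩ := hf
  refine ⟨Real.rpow_pos_of_pos hf0 s, _, hd.rpow_const (Or.inl hf0.ne'), ?_⟩
  rw [abs_mul, abs_mul, abs_of_pos (Real.rpow_pos_of_pos hf0 _)]
  calc |d| * |s| * f t ^ (s - 1) ≤ (M * f t) * |s| * f t ^ (s - 1) := by gcongr
    _ = |s| * M * (f t ^ (s - 1) * f t) := by ring
    _ = _ := by rw [← Real.rpow_add_one hf0.ne', sub_add_cancel]

lemma half_le_sinc {t : ℝ} (ht : 0 ≤ t) (ht' : t ≤ π / 2) : 1 / 2 ≤ Real.sinc t := by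
  rcases ht.eq_or_lt with rfl | h0
  · norm_num
  rw [Real.sinc_of_ne_zero h0.ne', le_div_iff₀ h0]
  have h1 := Real.mul_le_sin ht ht'
  have h2 : 1 / 2 ≤ 2 / π := by
    rw [div_le_div_iff₀ (by norm_num) Real.pi_pos]; linarith [Real.pi_le_four]
  exact (mul_le_mul_of_nonneg_right h2 ht).trans h1

lemma logDerivBound_sinc {t : ℝ} (ht : 0 < t) (ht' : t ≤ π / 2) :
    LogDerivBound Real.sinc 2 t := by
  have hs := half_le_sinc ht.le ht'
  refine ⟨by linarith, (Real.cos t * t - Real.sin t * 1) / t ^ 2, ?_, ?_⟩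
  · refine ((Real.hasDerivAt_sin t).div (hasDerivAt_id t) ht.ne').congr_of_eventuallyEq ?_
    filter_upwards [eventually_ne_nhds ht.ne'] with x hx
    simp [Real.sinc_of_ne_zero hx]
  · have h1 := Real.one_sub_sq_div_two_le_cos (x := t)
    have h2 := Real.sin_le ht.le
    have h3 : Real.cos t * t ≤ Real.sin t := by
      have hc : 0 ≤ Real.cos t := Real.cos_nonneg_of_neg_pi_div_two_le_of_le (by linarith) ht'
      rcases ht'.eq_or_lt with h | h
      · rw [h]; simp
      · have := Real.lt_tan ht h
        have hc' : 0 < Real.cos t := Real.cos_pos_of_mem_Ioo ⟨by linarith, h⟩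
        rw [Real.tan_eq_sin_div_cos, lt_div_iff₀ hc'] at this
        linarith
    have h4 : t ≤ 2 := ht'.trans (by linarith [Real.pi_le_four])
    rw [abs_div, abs_of_nonneg (sq_nonneg t), div_le_iff₀ (by positivity), abs_of_nonpos (by linarith)]
    nlinarith

lemma fifth_le_sin {x : ℝ} (hx : 0 ≤ x) (hx' : x ≤ 3 * π / 4) : x / 5 ≤ Real.sin x := by
  rcases le_total x (π / 2) with h | h
  · have h1 := Real.mul_le_sin hx h
    have h2 : 1 / 5 ≤ 2 / π := by
      rw [div_le_div_iff₀ (by norm_num) Real.pi_pos]; linarith [Real.pi_le_four]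
    linarith [mul_le_mul_of_nonneg_right h2 hx]
  · have h1 := Real.mul_le_sin (x := π - x) (by linarith) (by linarith)
    rw [Real.sin_pi_sub] at h1
    have h2 : 2 / π * (π / 4) ≤ 2 / π * (π - x) :=
      mul_le_mul_of_nonneg_left (by linarith) (by positivity)
    have h3 : 2 / π * (π / 4) = 1 / 2 := by field_simp; norm_num
    linarith [Real.pi_lt_d2]

lemma half_le_cos {x : ℝ} (hx : 0 ≤ x) (hx' : x ≤ π / 4) : 1 / 2 ≤ Real.cos x := by
  have h1 := Real.one_sub_sq_div_two_le_cos (x := x)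
  have h2 : x ≤ 1 := hx'.trans (by linarith [Real.pi_le_four])
  nlinarith

/-- The amplitude multiplying `t^(μ-1)` after moving the endpoint `φ` to the origin. -/
noncomputable def oscAmp (mu p r φ t : ℝ) : ℝ :=
  Real.sinc t ^ (mu - 1) * Real.sin (2 * φ + t) ^ (mu - 1) *
    Real.sin ((φ + t) / 2) ^ (-p) * Real.cos ((φ + t) / 2) ^ (-r)

lemma logDerivBound_oscAmp (mu p r : ℝ) {φ t : ℝ} (hφ : 0 < φ) (ht : 0 < t)
    (hφt : φ + t ≤ π / 2) (hφ' : φ ≤ π / 4) :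
    LogDerivBound (oscAmp mu p r φ)
      ((9 * |mu - 1| + 4 * |p| + 4 * |r|) * (φ + t)⁻¹) t := by
  have hθ : 0 < φ + t := by linarith
  have hθ2 : φ + t ≤ 2 := hφt.trans (by linarith [Real.pi_le_four])
  have mono {f : ℝ → ℝ} {M M' : ℝ} (h : LogDerivBound f M t) (hM : M ≤ M') :
      LogDerivBound f M' t := by
    obtain ⟨h0, d, hd, hdb⟩ := h
    exact ⟨h0, d, hd, hdb.trans (mul_le_mul_of_nonneg_right hM h0.le)⟩
  have b1 : LogDerivBound Real.sinc (4 * (φ + t)⁻¹) t := by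
    refine mono (logDerivBound_sinc ht (by linarith)) ?_
    rw [← div_eq_mul_inv, le_div_iff₀ hθ]
    linarith
  have b2 : LogDerivBound (fun t => Real.sin (2 * φ + t)) (5 * (φ + t)⁻¹) t := by
    have h1 := fifth_le_sin (x := 2 * φ + t) (by linarith) (by linarith)
    refine ⟨by linarith, Real.cos (2 * φ + t), ?_, ?_⟩
    · simpa using ((hasDerivAt_id t).const_add (2 * φ)).sin
    · refine (Real.abs_cos_le_one _).trans ?_
      rw [← div_eq_mul_inv, div_mul_eq_mul_div, le_div_iff₀ hθ]
      linarith
  have hd : HasDerivAt (fun t => (φ + t) / 2) (1 / 2) t := by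
    simpa using ((hasDerivAt_id t).const_add φ).div_const 2
  have b3 : LogDerivBound (fun t => Real.sin ((φ + t) / 2)) (4 * (φ + t)⁻¹) t := by
    have h1 := fifth_le_sin (x := (φ + t) / 2) (by linarith) (by linarith [Real.pi_pos])
    have h1' := Real.mul_le_sin (x := (φ + t) / 2) (by linarith) (by linarith [Real.pi_pos])
    have h2 : 1 / 2 ≤ 2 / π := by
      rw [div_le_div_iff₀ (by norm_num) Real.pi_pos]; linarith [Real.pi_le_four]
    have h3 := mul_le_mul_of_nonneg_right h2 (by linarith : 0 ≤ (φ + t) / 2)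
    refine ⟨by linarith, _, hd.sin, ?_⟩
    rw [abs_mul, abs_of_pos (by norm_num : (0 : ℝ) < 1 / 2), ← div_eq_mul_inv,
      div_mul_eq_mul_div, le_div_iff₀ hθ]
    nlinarith [Real.abs_cos_le_one ((φ + t) / 2)]
  have b4 : LogDerivBound (fun t => Real.cos ((φ + t) / 2)) (4 * (φ + t)⁻¹) t := by
    have h1 := half_le_cos (x := (φ + t) / 2) (by linarith) (by linarith)
    refine ⟨by linarith, _, hd.cos, ?_⟩
    rw [abs_mul, abs_of_pos (by norm_num : (0 : ℝ) < 1 / 2), ← div_eq_mul_inv,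
      div_mul_eq_mul_div, le_div_iff₀ hθ, abs_neg]
    nlinarith [Real.abs_sin_le_one ((φ + t) / 2), abs_nonneg (Real.sin ((φ + t) / 2))]
  refine mono ((((b1.rpow (mu - 1)).mul (b2.rpow (mu - 1))).mul (b3.rpow (-p))).mul
    (b4.rpow (-r))) (le_of_eq ?_)
  rw [abs_neg, abs_neg]
  ring

lemma exists_oscAmp_compare (mu p r : ℝ) : ∃ C : ℝ, 0 < C ∧ ∀ φ t : ℝ, 0 < φ → φ ≤ π / 4 →
    0 ≤ t → φ + t ≤ π / 2 → oscAmp mu p r φ t ≤ C * (φ + t) ^ (mu - 1 - p) ∧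
      (φ + t) ^ (mu - 1 - p) ≤ C * oscAmp mu p r φ t := by
  obtain ⟨C₁, hC₁, h₁⟩ := exists_rpow_compare (mu - 1) (by norm_num : (0 : ℝ) < 1 / 2) one_pos
  obtain ⟨C₂, hC₂, h₂⟩ := exists_rpow_compare (mu - 1) (by norm_num : (0 : ℝ) < 1 / 5) two_pos
  obtain ⟨C₃, hC₃, h₃⟩ := exists_rpow_compare (-p) (by norm_num : (0 : ℝ) < 1 / 10) one_pos
  obtain ⟨C₄, hC₄, h₄⟩ := exists_rpow_compare (-r) (by norm_num : (0 : ℝ) < 1 / 2) one_pos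
  refine ⟨C₁ * C₂ * C₃ * C₄, by positivity, fun φ t hφ hφ' ht hφt => ?_⟩
  have hθ : 0 < φ + t := by linarith
  have s1 := half_le_sinc ht (by linarith)
  have s2 := fifth_le_sin (x := 2 * φ + t) (by linarith) (by linarith)
  have s3 := fifth_le_sin (x := (φ + t) / 2) (by linarith) (by linarith [Real.pi_pos])
  have s4 := half_le_cos (x := (φ + t) / 2) (by linarith) (by linarith)
  have e1 := h₁ (Real.sinc t) 1 one_pos (by linarith) (by linarith [Real.sinc_le_one t])
  have e2 := h₂ (Real.sin (2 * φ + t)) (φ + t) hθ (by linarith)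
    (by linarith [Real.sin_le (x := 2 * φ + t) (by linarith)])
  have e3 := h₃ (Real.sin ((φ + t) / 2)) (φ + t) hθ (by linarith)
    (by linarith [Real.sin_le (x := (φ + t) / 2) (by linarith)])
  have e4 := h₄ (Real.cos ((φ + t) / 2)) 1 one_pos (by linarith)
    (by linarith [Real.cos_le_one ((φ + t) / 2)])
  rw [Real.one_rpow, mul_one] at e1 e4
  have p1 : 0 < Real.sinc t ^ (mu - 1) := Real.rpow_pos_of_pos (by linarith) _
  have p2 : 0 < Real.sin (2 * φ + t) ^ (mu - 1) := Real.rpow_pos_of_pos (by linarith) _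
  have p3 : 0 < Real.sin ((φ + t) / 2) ^ (-p) := Real.rpow_pos_of_pos (by linarith) _
  have p4 : 0 < Real.cos ((φ + t) / 2) ^ (-r) := Real.rpow_pos_of_pos (by linarith) _
  have hsplit : (φ + t) ^ (mu - 1 - p) = (φ + t) ^ (mu - 1) * (φ + t) ^ (-p) := by
    rw [← Real.rpow_add hθ, sub_eq_add_neg]
  have q1 := Real.rpow_pos_of_pos hθ (mu - 1)
  have q2 := Real.rpow_pos_of_pos hθ (-p)
  rw [hsplit, oscAmp]
  constructor
  · calc Real.sinc t ^ (mu - 1) * Real.sin (2 * φ + t) ^ (mu - 1) *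
          Real.sin ((φ + t) / 2) ^ (-p) * Real.cos ((φ + t) / 2) ^ (-r)
        ≤ C₁ * (C₂ * (φ + t) ^ (mu - 1)) * (C₃ * (φ + t) ^ (-p)) * C₄ := by
          gcongr
          exacts [e1.1, e2.1, e3.1, e4.1]
      _ = _ := by ring
  · calc (φ + t) ^ (mu - 1) * (φ + t) ^ (-p)
        = 1 * (φ + t) ^ (mu - 1) * (φ + t) ^ (-p) * 1 := by ring
      _ ≤ (C₁ * Real.sinc t ^ (mu - 1)) * (C₂ * Real.sin (2 * φ + t) ^ (mu - 1)) *
          (C₃ * Real.sin ((φ + t) / 2) ^ (-p)) * (C₄ * Real.cos ((φ + t) / 2) ^ (-r)) := by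
          gcongr
          exacts [e1.2, e2.2, e3.2, e4.2]
      _ = _ := by ring

lemma continuousOn_oscAmp (mu p r : ℝ) {φ : ℝ} (hφ : 0 < φ) (hφ' : φ ≤ π / 4) :
    ContinuousOn (oscAmp mu p r φ) (Set.Icc 0 (π / 2 - φ)) := by
  intro t ht
  have s1 := half_le_sinc ht.1 (by linarith [ht.2])
  have s2 := fifth_le_sin (x := 2 * φ + t) (by linarith [ht.1]) (by linarith [ht.2])
  have s3 := fifth_le_sin (x := (φ + t) / 2) (by linarith [ht.1])
    (by linarith [ht.2, Real.pi_pos])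
  have s4 := half_le_cos (x := (φ + t) / 2) (by linarith [ht.1]) (by linarith [ht.2])
  have ht0 := ht.1
  unfold oscAmp
  refine ContinuousAt.continuousWithinAt ?_
  refine ((ContinuousAt.mul ?_ ?_).mul ?_).mul ?_
  · exact Real.continuous_sinc.continuousAt.rpow_const (Or.inl (by linarith))
  · exact ContinuousAt.rpow_const (by fun_prop) (Or.inl (by linarith))
  · exact ContinuousAt.rpow_const (by fun_prop) (Or.inl (by linarith))
  · exact ContinuousAt.rpow_const (by fun_prop) (Or.inl (by linarith))

lemma exists_oscAmp_expansion {mu : ℝ} (p r : ℝ) (hmu1 : 0 < mu) (hmu2 : mu < 1)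
    (hp : 0 < p + 2 - 2 * mu) : ∃ C : ℝ, 0 < C ∧ ∀ φ N : ℝ, 0 < φ → φ ≤ π / 4 → 0 < N →
      ‖(∫ t in (0 : ℝ)..(π / 2 - φ), ((t ^ (mu - 1) * oscAmp mu p r φ t : ℝ) : ℂ) *
        Complex.exp ((N * t : ℝ) * Complex.I)) -
        ((oscAmp mu p r φ 0 * N ^ (-mu) : ℝ) : ℂ) * oscTail mu 0‖ ≤
      C * (N⁻¹ * φ ^ (2 * mu - 2 - p)) := by
  obtain ⟨C, hC, hcmp⟩ := exists_oscAmp_compare mu p r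
  set M := 9 * |mu - 1| + 4 * |p| + 4 * |r| with hM
  have hM0 : 0 ≤ M := by positivity
  set e := p + 2 - mu with he
  have hpi := Real.pi_pos
  refine ⟨C * (π / 2) ^ (mu - 1 - p) * (π / 4) ^ (mu - 1) +
    M * C * (1 / mu + 1 / (e - mu)), ?_, fun φ N hφ hφ' hN => ?_⟩
  · have : 0 < e - mu := by rw [he]; linarith
    positivity
  have hamp0 (t : ℝ) (ht : 0 ≤ t) (ht' : φ + t ≤ π / 2) : 0 ≤ oscAmp mu p r φ t := by
    have h1 := (hcmp φ t hφ hφ' ht ht').2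
    have h2 := Real.rpow_nonneg (by linarith : 0 ≤ φ + t) (mu - 1 - p)
    exact nonneg_of_mul_nonneg_right (h2.trans h1) hC
  have hld (t : ℝ) (ht : t ∈ Set.Ioo 0 (π / 2 - φ)) :=
    logDerivBound_oscAmp mu p r hφ ht.1 (by linarith [ht.2]) hφ'
  have key := norm_integral_rpow_mul_exp_sub_le (K := M * C) (e := e) (T := π / 2 - φ)
    hmu1 hmu2 hφ (by linarith) (by rw [he]; linarith) hN (by positivity)
    (continuousOn_oscAmp mu p r hφ hφ')
    (fun t ht => (hld t ht).2.choose_spec.1.differentiableAt) (fun t ht => ?_)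
  · refine key.trans ?_
    have hme : mu - e = 2 * mu - 2 - p := by rw [he]; ring
    have h1 : (1 : ℝ) ≤ φ ^ (2 * mu - 2 - p) :=
      Real.one_le_rpow_of_pos_of_le_one_of_nonpos hφ (by linarith [Real.pi_le_four]) (by linarith)
    have h2 : |oscAmp mu p r φ (π / 2 - φ)| ≤ C * (π / 2) ^ (mu - 1 - p) := by
      rw [abs_of_nonneg (hamp0 _ (by linarith) (by linarith))]
      simpa using (hcmp φ (π / 2 - φ) hφ hφ' (by linarith) (by linarith)).1
    have h3 : (π / 2 - φ) ^ (mu - 1) ≤ (π / 4) ^ (mu - 1) :=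
      Real.rpow_le_rpow_of_nonpos (by positivity) (by linarith) (by linarith)
    rw [hme]
    have h4 : 0 ≤ C * (π / 2) ^ (mu - 1 - p) * (π / 4) ^ (mu - 1) := by positivity
    have h5 : |oscAmp mu p r φ (π / 2 - φ)| * (π / 2 - φ) ^ (mu - 1) ≤
        C * (π / 2) ^ (mu - 1 - p) * (π / 4) ^ (mu - 1) :=
      mul_le_mul h2 h3 (Real.rpow_nonneg (by linarith) _) (by positivity)
    have h6 := h5.trans (le_mul_of_one_le_right h4 h1)
    have hN' := inv_pos.2 hN
    calc _ ≤ N⁻¹ * (C * (π / 2) ^ (mu - 1 - p) * (π / 4) ^ (mu - 1) * φ ^ (2 * mu - 2 - p) +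
          M * C * ((1 / mu + 1 / (e - mu)) * φ ^ (2 * mu - 2 - p))) := by gcongr
      _ = _ := by ring
  · obtain ⟨h0, d, hd, hdb⟩ := hld t ht
    have hθ : 0 < φ + t := by linarith [ht.1]
    rw [hd.deriv]
    refine hdb.trans ?_
    have h1 := (hcmp φ t hφ hφ' ht.1.le (by linarith [ht.2])).1
    have h2 : (φ + t) ^ (-e) = (φ + t)⁻¹ * (φ + t) ^ (mu - 1 - p) := by
      rw [← Real.rpow_neg_one, ← Real.rpow_add hθ, he]; ring_nf
    rw [h2]
    calc M * (φ + t)⁻¹ * oscAmp mu p r φ t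
        ≤ M * (φ + t)⁻¹ * (C * (φ + t) ^ (mu - 1 - p)) := by gcongr
      _ = _ := by ring

lemma cos_sq_sub_cos_sq_add (φ t : ℝ) :
    Real.cos φ ^ 2 - Real.cos (φ + t) ^ 2 = Real.sin t * Real.sin (2 * φ + t) := by
  rw [show 2 * φ + t = φ + (φ + t) by ring, Real.sin_add φ (φ + t), Real.sin_add φ t,
    Real.cos_add φ t]
  have h1 := Real.sin_sq_add_cos_sq φ
  have h2 := Real.sin_sq_add_cos_sq t
  linear_combination (-Real.cos φ ^ 2) * h2

lemma mul_sinc (t : ℝ) : t * Real.sinc t = Real.sin t := by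
  rcases eq_or_ne t 0 with rfl | h
  · simp
  · rw [Real.sinc_of_ne_zero h, mul_div_cancel₀ _ h]

lemma rpow_mul_oscAmp (mu p r : ℝ) {φ t : ℝ} (hφ : 0 < φ) (hφ' : φ ≤ π / 4) (ht : 0 ≤ t)
    (ht' : t ≤ π / 2 - φ) :
    t ^ (mu - 1) * oscAmp mu p r φ t = (Real.cos φ ^ 2 - Real.cos (φ + t) ^ 2) ^ (mu - 1) *
      Real.sin ((φ + t) / 2) ^ (-p) * Real.cos ((φ + t) / 2) ^ (-r) := by
  have s1 := half_le_sinc ht (by linarith)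
  have s2 := fifth_le_sin (x := 2 * φ + t) (by linarith) (by linarith)
  have h0 : 0 ≤ Real.sin t := Real.sin_nonneg_of_nonneg_of_le_pi ht (by linarith [Real.pi_pos])
  rw [cos_sq_sub_cos_sq_add, Real.mul_rpow h0 (by linarith), ← mul_sinc t,
    Real.mul_rpow ht (by linarith), oscAmp]
  ring

lemma intervalIntegrable_rpow_mul_oscAmp_mul {mu : ℝ} (p r : ℝ) {φ : ℝ} (hmu1 : 0 < mu)
    (hφ : 0 < φ) (hφ' : φ ≤ π / 4) {g : ℝ → ℝ} (hg : Continuous g) :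
    IntervalIntegrable (fun t => t ^ (mu - 1) * oscAmp mu p r φ t * g t) volume 0
      (π / 2 - φ) := by
  have h1 : IntervalIntegrable (fun t : ℝ => t ^ (mu - 1)) volume 0 (π / 2 - φ) :=
    intervalIntegrable_rpow' (by linarith)
  have h2 := continuousOn_oscAmp mu p r hφ hφ'
  rw [← Set.uIcc_of_le (by linarith [Real.pi_pos] : (0 : ℝ) ≤ π / 2 - φ)] at h2
  exact (h1.mul_continuousOn h2).mul_continuousOn hg.continuousOn

lemma integral_rpow_mul_oscAmp_mul_cos {mu : ℝ} (p r : ℝ) {φ : ℝ} (hmu1 : 0 < mu)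
    (hφ : 0 < φ) (hφ' : φ ≤ π / 4) (N α : ℝ) :
    ∫ t in (0 : ℝ)..(π / 2 - φ), t ^ (mu - 1) * oscAmp mu p r φ t * Real.cos (N * t + α) =
      (Complex.exp (α * Complex.I) *
        ∫ t in (0 : ℝ)..(π / 2 - φ), ((t ^ (mu - 1) * oscAmp mu p r φ t : ℝ) : ℂ) *
        Complex.exp ((N * t : ℝ) * Complex.I)).re := by
  rw [← intervalIntegral.integral_const_mul]
  have hInt : IntervalIntegrable (fun t : ℝ => Complex.exp (α * Complex.I) *
      (((t ^ (mu - 1) * oscAmp mu p r φ t : ℝ) : ℂ) *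
        Complex.exp ((N * t : ℝ) * Complex.I))) volume 0 (π / 2 - φ) := by
    have h1 := intervalIntegrable_ofReal (intervalIntegrable_rpow_mul_oscAmp_mul p r hmu1 hφ hφ'
      (continuous_const (y := (1 : ℝ))))
    simp only [mul_one] at h1
    exact (h1.mul_continuousOn (by fun_prop)).const_mul _
  have h2 := Complex.reCLM.intervalIntegral_comp_comm hInt
  rw [Complex.reCLM_apply] at h2
  rw [← h2]
  refine integral_congr fun t _ => ?_
  simp only [Complex.reCLM_apply]
  rw [mul_left_comm, Complex.re_ofReal_mul, ← Complex.exp_add, ← add_mul, ← Complex.ofReal_add,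
    Complex.exp_ofReal_mul_I_re, add_comm α]

lemma Mosc_eq_re_add_re (lam δ : ℝ) {mu : ℝ} (n : ℕ) {φ : ℝ} (hmu1 : 0 < mu) (hφ : 0 < φ)
    (hφ' : φ ≤ π / 4) {a b N τ : ℝ} (ha : a = lam + mu + δ) (hb : b = lam + mu - 1)
    (hN : N = n + (a + b) / 2 + 1) (hτ : τ = -(π * (a + 1) / 2)) :
    Mosc lam mu δ n φ =
      (Complex.exp ((N * φ + τ : ℝ) * Complex.I) *
        ∫ t in (0 : ℝ)..(π / 2 - φ), ((t ^ (mu - 1) * oscAmp mu a b φ t : ℝ) : ℂ) *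
        Complex.exp ((N * t : ℝ) * Complex.I)).re +
      (Complex.exp ((N * φ - N * π - τ : ℝ) * Complex.I) *
        ∫ t in (0 : ℝ)..(π / 2 - φ), ((t ^ (mu - 1) * oscAmp mu b a φ t : ℝ) : ℂ) *
        Complex.exp ((N * t : ℝ) * Complex.I)).re := by
  have hpi := Real.pi_pos
  rw [← integral_rpow_mul_oscAmp_mul_cos a b hmu1 hφ hφ',
    ← integral_rpow_mul_oscAmp_mul_cos b a hmu1 hφ hφ']
  set f : ℝ → ℝ := fun θ => (Real.cos φ ^ 2 - Real.cos θ ^ 2) ^ (mu - 1) *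
      (Real.sin (θ / 2)) ^ (-a) * (Real.cos (θ / 2)) ^ (-b) * Real.cos (N * θ + τ) with hf
  have hM : Mosc lam mu δ n φ = ∫ θ in φ..(π - φ), f θ := by
    rw [Mosc, hf, hτ, hN, ha, hb]
  set g₁ : ℝ → ℝ := fun t => t ^ (mu - 1) * oscAmp mu a b φ t * Real.cos (N * t + (N * φ + τ))
    with hg₁
  set g₂ : ℝ → ℝ := fun t => t ^ (mu - 1) * oscAmp mu b a φ t *
    Real.cos (N * t + (N * φ - N * π - τ)) with hg₂
  have hf1 (t : ℝ) (ht : 0 ≤ t) (ht' : t ≤ π / 2 - φ) : f (φ + t) = g₁ t := by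
    simp only [hf, hg₁]
    rw [rpow_mul_oscAmp mu a b hφ hφ' ht ht']
    ring_nf
  have hf2 (t : ℝ) (ht : 0 ≤ t) (ht' : t ≤ π / 2 - φ) : f (π - φ - t) = g₂ t := by
    simp only [hf, hg₂]
    rw [rpow_mul_oscAmp mu b a hφ hφ' ht ht', show π - φ - t = π - (φ + t) by ring,
      Real.cos_pi_sub, neg_sq, sub_div, Real.sin_pi_div_two_sub, Real.cos_pi_div_two_sub,
      ← Real.cos_neg (N * (π - (φ + t)) + τ)]
    ring_nf
  have hi1 : IntervalIntegrable g₁ volume 0 (π / 2 - φ) :=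
    intervalIntegrable_rpow_mul_oscAmp_mul a b hmu1 hφ hφ' (by fun_prop)
  have hi2 : IntervalIntegrable g₂ volume 0 (π / 2 - φ) :=
    intervalIntegrable_rpow_mul_oscAmp_mul b a hmu1 hφ hφ' (by fun_prop)
  have hfi1 : IntervalIntegrable f volume φ (π / 2) := by
    have h1 := hi1.comp_sub_right φ
    rw [zero_add, sub_add_cancel] at h1
    refine h1.congr fun θ hθ => ?_
    rw [Set.uIoc_of_le (by linarith)] at hθ
    have := hf1 (θ - φ) (by linarith [hθ.1]) (by linarith [hθ.2])
    rw [add_sub_cancel] at this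
    exact this.symm
  have hfi2 : IntervalIntegrable f volume (π / 2) (π - φ) := by
    have h1 := (hi2.comp_sub_left (π - φ)).symm
    rw [sub_zero, show π - φ - (π / 2 - φ) = π / 2 by ring] at h1
    refine h1.congr fun θ hθ => ?_
    rw [Set.uIoc_of_le (by linarith)] at hθ
    have := hf2 (π - φ - θ) (by linarith [hθ.2]) (by linarith [hθ.1])
    rw [sub_sub_cancel] at this
    exact this.symm
  rw [hM, ← integral_add_adjacent_intervals hfi1 hfi2]
  congr 1
  · have h1 := intervalIntegral.integral_comp_add_left (a := 0) (b := π / 2 - φ) f φ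
    rw [add_zero, add_sub_cancel] at h1
    rw [← h1]
    refine integral_congr fun t ht => ?_
    rw [Set.uIcc_of_le (by linarith)] at ht
    exact hf1 t ht.1 ht.2
  · have h1 := intervalIntegral.integral_comp_sub_left (a := 0) (b := π / 2 - φ) f (π - φ)
    rw [sub_zero, show π - φ - (π / 2 - φ) = π / 2 by ring] at h1
    rw [← h1]
    refine integral_congr fun t ht => ?_
    rw [Set.uIcc_of_le (by linarith)] at ht
    exact hf2 t ht.1 ht.2

lemma re_exp_mul_eq (α x : ℝ) (κ : ℂ) :
    (Complex.exp (α * Complex.I) * ((x : ℂ) * κ)).re = x * ‖κ‖ * Real.cos (α + κ.arg) := by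
  conv_lhs => rw [← Complex.norm_mul_exp_arg_mul_I κ]
  rw [show Complex.exp (α * Complex.I) * ((x : ℂ) * (‖κ‖ * Complex.exp (κ.arg * Complex.I))) =
    ((x * ‖κ‖ : ℝ) : ℂ) * (Complex.exp (α * Complex.I) * Complex.exp (κ.arg * Complex.I)) by
    push_cast; ring, Complex.re_ofReal_mul, ← Complex.exp_add, ← add_mul, ← Complex.ofReal_add,
    Complex.exp_ofReal_mul_I_re]

lemma abs_re_exp_mul_sub_le (α x : ℝ) (κ J : ℂ) :
    |(Complex.exp (α * Complex.I) * J).re - x * ‖κ‖ * Real.cos (α + κ.arg)| ≤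
      ‖J - (x : ℂ) * κ‖ := by
  rw [← re_exp_mul_eq, ← Complex.sub_re, ← mul_sub]
  refine (Complex.abs_re_le_norm _).trans ?_
  rw [norm_mul, Complex.norm_exp_ofReal_mul_I, one_mul]

lemma sub_le_abs_add {X Y R₁ R₂ x y u v : ℝ} (hX : x ≤ |X|) (hY : |Y| ≤ y)
    (h₁ : |R₁ - X| ≤ u) (h₂ : |R₂ - Y| ≤ v) : x - y - u - v ≤ |R₁ + R₂| := by
  have q2 := abs_sub_abs_le_abs_sub X (X - R₁)
  have q3 := abs_add_le (R₁ + R₂) (-Y - (R₂ - Y))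
  have q4 := abs_sub (-Y) (R₂ - Y)
  rw [abs_neg] at q4
  rw [show R₁ + R₂ + (-Y - (R₂ - Y)) = R₁ by ring] at q3
  rw [show X - (X - R₁) = R₁ by ring, abs_sub_comm X R₁] at q2
  linarith

/-- Pointwise lower bound for the weighted oscillatory integral. -/
lemma exists_Mosc_lower_bound (lam mu δ : ℝ) (hmu1 : 0 < mu) (hmu2 : mu < 1)
    (hlam : 0 ≤ lam) (hδ1 : -1 < δ) :
    ∃ c C β : ℝ, 0 < c ∧ 0 < C ∧ ∀ (n : ℕ) (N φ : ℝ), N = n + (lam + mu + δ / 2 + 1 / 2) →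
      0 < φ → φ ≤ π / 4 →
      N ^ (-mu) * (φ ^ (lam - δ - 1) * (c * Real.cos (N * φ + β) ^ 2 - C * φ ^ (δ + 1) -
        C * (N * φ) ^ (mu - 1))) ≤ |Mosc lam mu δ n φ| * Real.sin φ ^ (2 * lam) := by
  set a := lam + mu + δ with ha
  set b := lam + mu - 1 with hb
  set τ := -(π * (a + 1) / 2) with hτ
  set κ := oscTail mu 0 with hκ
  have hκ0 : 0 < ‖κ‖ := norm_pos_iff.2 (oscTail_zero_ne_zero hmu1)
  obtain ⟨C₁, hC₁, h₁⟩ := exists_oscAmp_compare mu a b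
  obtain ⟨C₂, hC₂, h₂⟩ := exists_oscAmp_compare mu b a
  obtain ⟨C₃, hC₃, h₃⟩ := exists_oscAmp_expansion a b hmu1 hmu2 (by rw [ha]; linarith)
  obtain ⟨C₄, hC₄, h₄⟩ := exists_oscAmp_expansion b a hmu1 hmu2 (by rw [hb]; linarith)
  obtain ⟨C₅, hC₅, h₅⟩ := exists_rpow_compare (2 * lam) (by norm_num : (0 : ℝ) < 1 / 5) one_pos
  refine ⟨C₅⁻¹ * (C₁⁻¹ * ‖κ‖), C₅⁻¹ * (C₂ * ‖κ‖ + C₃ + C₄), τ + κ.arg, by positivity,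
    by positivity, fun n N φ hN hφ hφ' => ?_⟩
  have hN' : N = n + (a + b) / 2 + 1 := by rw [hN, ha, hb]; ring
  have hN0 : 0 < N := by
    rw [hN]; have : (0 : ℝ) ≤ n := n.cast_nonneg; linarith
  have hφ1 : φ ≤ 1 := by linarith [Real.pi_le_four]
  have hpi := Real.pi_pos
  have e1 := (h₁ φ 0 hφ hφ' le_rfl (by linarith)).2
  have e2 := (h₂ φ 0 hφ hφ' le_rfl (by linarith)).1
  rw [add_zero] at e1 e2
  have e3 := (abs_re_exp_mul_sub_le (N * φ + τ) (oscAmp mu a b φ 0 * N ^ (-mu)) κ _).trans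
    (h₃ φ N hφ hφ' hN0)
  have e4 := (abs_re_exp_mul_sub_le (N * φ - N * π - τ) (oscAmp mu b a φ 0 * N ^ (-mu)) κ
    _).trans (h₄ φ N hφ hφ' hN0)
  have hM := Mosc_eq_re_add_re lam δ n hmu1 hφ hφ' ha hb hN' hτ
  set R₁ := (Complex.exp ((N * φ + τ : ℝ) * Complex.I) *
        ∫ t in (0 : ℝ)..(π / 2 - φ), ((t ^ (mu - 1) * oscAmp mu a b φ t : ℝ) : ℂ) *
        Complex.exp ((N * t : ℝ) * Complex.I)).re with hR₁
  set R₂ := (Complex.exp ((N * φ - N * π - τ : ℝ) * Complex.I) *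
        ∫ t in (0 : ℝ)..(π / 2 - φ), ((t ^ (mu - 1) * oscAmp mu b a φ t : ℝ) : ℂ) *
        Complex.exp ((N * t : ℝ) * Complex.I)).re with hR₂
  have e5 := (h₅ (Real.sin φ) φ hφ
    (by linarith [fifth_le_sin hφ.le (by linarith)]) (by linarith [Real.sin_le hφ.le])).2
  set P := φ ^ (mu - 1 - a) with hP
  have hP0 : 0 < P := Real.rpow_pos_of_pos hφ _
  set F := N ^ (-mu) with hF
  have hF0 : 0 < F := Real.rpow_pos_of_pos hN0 _
  set D := φ ^ (δ + 1) with hD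
  set S := (N * φ) ^ (mu - 1) with hS
  have k1 : φ ^ (mu - 1 - b) = P * D := by
    rw [hP, hD, ← Real.rpow_add hφ, ha, hb]; ring_nf
  have k2 : N⁻¹ * φ ^ (2 * mu - 2 - a) = F * P * S := by
    have : 2 * mu - 2 - a = (mu - 1 - a) + (mu - 1) := by ring
    rw [this, Real.rpow_add hφ, hF, hS, Real.mul_rpow hN0.le hφ.le, ← Real.rpow_neg_one,
      show (-1 : ℝ) = -mu + (mu - 1) by ring, Real.rpow_add hN0]
    ring
  have k3 : N⁻¹ * φ ^ (2 * mu - 2 - b) ≤ F * P * S := by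
    rw [← k2]
    exact mul_le_mul_of_nonneg_left (Real.rpow_le_rpow_of_exponent_ge hφ hφ1
      (by rw [ha, hb]; linarith)) (inv_pos.2 hN0).le
  have k4 : φ ^ (lam - δ - 1) = P * φ ^ (2 * lam) := by
    rw [hP, ← Real.rpow_add hφ, ha]; ring_nf
  set γ := N * φ + τ + κ.arg with hγ
  have hγ' : N * φ + (τ + κ.arg) = γ := by rw [hγ]; ring
  rw [hγ', k4]
  have m1 : C₁⁻¹ * P ≤ oscAmp mu a b φ 0 := by
    rw [inv_mul_le_iff₀ hC₁]; exact e1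
  have m2 : F * (C₁⁻¹ * P) * ‖κ‖ * Real.cos γ ^ 2 ≤
      |oscAmp mu a b φ 0 * F * ‖κ‖ * Real.cos γ| := by
    have hq : 0 ≤ oscAmp mu a b φ 0 := le_trans (by positivity) m1
    have hc : Real.cos γ ^ 2 ≤ |Real.cos γ| := by
      rw [← sq_abs]; nlinarith [abs_nonneg (Real.cos γ), Real.abs_cos_le_one γ]
    rw [abs_mul, abs_of_nonneg (by positivity : 0 ≤ oscAmp mu a b φ 0 * F * ‖κ‖),
      mul_comm F]
    gcongr
  have m3 : |oscAmp mu b a φ 0 * F * ‖κ‖ * Real.cos (N * φ - N * π - τ + κ.arg)| ≤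
      C₂ * (P * D) * F * ‖κ‖ := by
    have hq : 0 ≤ oscAmp mu b a φ 0 := by
      have := (h₂ φ 0 hφ hφ' le_rfl (by linarith)).2
      exact nonneg_of_mul_nonneg_right ((Real.rpow_nonneg (by linarith) _).trans this) hC₂
    rw [k1] at e2
    rw [abs_mul, abs_of_nonneg (by positivity : 0 ≤ oscAmp mu b a φ 0 * F * ‖κ‖)]
    refine (mul_le_of_le_one_right (by positivity) (Real.abs_cos_le_one _)).trans ?_
    gcongr
  have m4 : F * (P * (C₁⁻¹ * ‖κ‖ * Real.cos γ ^ 2 - (C₂ * ‖κ‖ + C₃ + C₄) * D -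
      (C₂ * ‖κ‖ + C₃ + C₄) * S)) ≤ |Mosc lam mu δ n φ| := by
    have hD0 : 0 < D := Real.rpow_pos_of_pos hφ _
    have hS0 : 0 < S := Real.rpow_pos_of_pos (mul_pos hN0 hφ) _
    have z1 : 0 ≤ (C₃ + C₄) * (F * P * D) := by positivity
    have z2 : 0 ≤ C₂ * ‖κ‖ * (F * P * S) := by positivity
    rw [k2] at e3
    have e4' := e4.trans (mul_le_mul_of_nonneg_left k3 hC₄.le)
    rw [hM]
    refine le_trans ?_ (sub_le_abs_add m2 m3 e3 e4')
    linarith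
  calc F * (P * φ ^ (2 * lam) * (C₅⁻¹ * (C₁⁻¹ * ‖κ‖) * Real.cos γ ^ 2 -
        C₅⁻¹ * (C₂ * ‖κ‖ + C₃ + C₄) * D - C₅⁻¹ * (C₂ * ‖κ‖ + C₃ + C₄) * S))
      = F * (P * (C₁⁻¹ * ‖κ‖ * Real.cos γ ^ 2 - (C₂ * ‖κ‖ + C₃ + C₄) * D -
      (C₂ * ‖κ‖ + C₃ + C₄) * S)) * (C₅⁻¹ * φ ^ (2 * lam)) := by ring
    _ ≤ |Mosc lam mu δ n φ| * (C₅⁻¹ * φ ^ (2 * lam)) :=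
        mul_le_mul_of_nonneg_right m4 (by positivity)
    _ ≤ _ := by
        refine mul_le_mul_of_nonneg_left ?_ (abs_nonneg _)
        rw [inv_mul_le_iff₀ hC₅]
        exact e5

/-- Holomorphic extension of `arccos` to the unit disc. -/
noncomputable def complexArccos (y : ℂ) : ℂ :=
  (π : ℂ) / 2 - Complex.I * Complex.log ((1 - y ^ 2) ^ (1 / 2 : ℂ) - Complex.I * y)

lemma re_one_sub_sq_pos {y : ℂ} (hy : ‖y‖ < 1) : 0 < (1 - y ^ 2).re := by
  have h1 : (y ^ 2).re ≤ ‖y‖ ^ 2 := by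
    rw [← norm_pow]; exact Complex.re_le_norm _
  have h2 : ‖y‖ ^ 2 < 1 := by nlinarith [norm_nonneg y]
  rw [Complex.sub_re, Complex.one_re]
  linarith

lemma re_cpow_half_pos {w : ℂ} (hw : 0 < w.re) : 0 < (w ^ (1 / 2 : ℂ)).re := by
  have h0 : w ≠ 0 := by
    rintro rfl; simp at hw
  rw [Complex.cpow_def_of_ne_zero h0, Complex.exp_re]
  refine mul_pos (Real.exp_pos _) (Real.cos_pos_of_mem_Ioo ?_)
  have h1 : (Complex.log w * (1 / 2)).im = w.arg / 2 := by
    rw [show Complex.log w * (1 / 2) = Complex.log w / 2 by ring, Complex.div_ofNat_im,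
      Complex.log_im]
  rw [h1]
  have h2 := Complex.abs_arg_lt_pi_div_two_iff.2 (Or.inl hw)
  rw [abs_lt] at h2
  constructor <;> linarith [h2.1, h2.2]

lemma cpow_half_sq (w : ℂ) : (w ^ (1 / 2 : ℂ)) ^ 2 = w := by
  rw [one_div]
  exact Complex.cpow_nat_inv_pow w two_ne_zero

lemma re_cpow_half_sub_pos {y : ℂ} (hy : ‖y‖ < 1) :
    0 < ((1 - y ^ 2) ^ (1 / 2 : ℂ) - Complex.I * y).re := by
  set s := (1 - y ^ 2) ^ (1 / 2 : ℂ) with hs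
  have hs0 : 0 < s.re := re_cpow_half_pos (re_one_sub_sq_pos hy)
  have hs2 : s ^ 2 = 1 - y ^ 2 := cpow_half_sq _
  set Z := s - Complex.I * y with hZ
  have hmul : Z * (2 * s - Z) = 1 := by
    rw [hZ]
    linear_combination hs2 - y ^ 2 * Complex.I_sq
  have h0 : Z ≠ 0 := by
    intro h; rw [h] at hmul; simp at hmul
  have hinv : Z⁻¹ = 2 * s - Z := by
    field_simp
    exact hmul.symm
  have hre := congrArg Complex.re hinv
  have h2 : (2 * s - Z).re = 2 * s.re - Z.re := by
    rw [two_mul, two_mul, Complex.sub_re, Complex.add_re]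
  rw [Complex.inv_re, h2] at hre
  by_contra hneg
  push Not at hneg
  have := div_nonpos_of_nonpos_of_nonneg hneg (Complex.normSq_nonneg Z)
  linarith

/-- Holomorphic form of the amplitude of the oscillatory integral in the variable `cos θ`. -/
noncomputable def discAmp (a b N τ : ℝ) (y : ℂ) : ℂ :=
  ((1 - y) / 2) ^ ((-a / 2 : ℝ) : ℂ) * ((1 + y) / 2) ^ ((-b / 2 : ℝ) : ℂ) *
    ((1 - y ^ 2) ^ (1 / 2 : ℂ))⁻¹ * Complex.cos (N * complexArccos y + τ)

lemma differentiableOn_discAmp (a b N τ : ℝ) :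
    DifferentiableOn ℂ (discAmp a b N τ) (Metric.ball 0 1) := by
  intro y hy
  rw [mem_ball_zero_iff] at hy
  have h1 : 0 < ((1 - y) / 2).re := by
    rw [Complex.div_ofNat_re, Complex.sub_re, Complex.one_re]
    linarith [Complex.re_le_norm y]
  have h2 : 0 < ((1 + y) / 2).re := by
    rw [Complex.div_ofNat_re, Complex.add_re, Complex.one_re]
    linarith [neg_abs_le y.re, Complex.abs_re_le_norm y]
  have h3 := re_one_sub_sq_pos hy
  have h4 := re_cpow_half_sub_pos hy
  have h5 : ((1 - y ^ 2) ^ (1 / 2 : ℂ)) ≠ 0 := by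
    intro h; have := re_cpow_half_pos h3; rw [h] at this; simp at this
  have d1 : DifferentiableAt ℂ (fun y : ℂ => ((1 - y) / 2) ^ ((-a / 2 : ℝ) : ℂ)) y :=
    DifferentiableAt.cpow (by fun_prop) (by fun_prop) (Or.inl h1)
  have d2 : DifferentiableAt ℂ (fun y : ℂ => ((1 + y) / 2) ^ ((-b / 2 : ℝ) : ℂ)) y :=
    DifferentiableAt.cpow (by fun_prop) (by fun_prop) (Or.inl h2)
  have d3 : DifferentiableAt ℂ (fun y : ℂ => (1 - y ^ 2) ^ (1 / 2 : ℂ)) y :=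
    DifferentiableAt.cpow (by fun_prop) (by fun_prop) (Or.inl h3)
  have d4 : DifferentiableAt ℂ complexArccos y := by
    refine DifferentiableAt.sub (by fun_prop) (DifferentiableAt.mul (by fun_prop) ?_)
    exact DifferentiableAt.clog (d3.sub (by fun_prop)) (Or.inl h4)
  have d5 : DifferentiableAt ℂ (fun y => Complex.cos (N * complexArccos y + τ)) y :=
    DifferentiableAt.ccos ((d4.const_mul _).add_const _)
  exact (((d1.mul d2).mul (d3.inv h5)).mul d5).differentiableWithinAt

lemma complexArccos_cos {θ : ℝ} (h0 : 0 < θ) (h1 : θ < π) :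
    ((1 - (Real.cos θ : ℂ) ^ 2) ^ (1 / 2 : ℂ)) = (Real.sin θ : ℂ) ∧
      complexArccos (Real.cos θ) = θ := by
  have hs := Real.sin_pos_of_pos_of_lt_pi h0 h1
  have e1 : (1 - (Real.cos θ : ℂ) ^ 2) ^ (1 / 2 : ℂ) = (Real.sin θ : ℂ) := by
    have : (1 - (Real.cos θ : ℂ) ^ 2) = ((Real.sin θ ^ 2 : ℝ) : ℂ) := by
      rw [Real.sin_sq]; push_cast; ring
    rw [this, show (1 / 2 : ℂ) = ((1 / 2 : ℝ) : ℂ) by push_cast; ring,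
      ← Complex.ofReal_cpow (sq_nonneg _), ← Real.sqrt_eq_rpow, Real.sqrt_sq hs.le]
  refine ⟨e1, ?_⟩
  rw [complexArccos, e1]
  have e2 : (Real.sin θ : ℂ) - Complex.I * (Real.cos θ : ℂ) =
      Complex.exp (((θ - π / 2 : ℝ) : ℂ) * Complex.I) := by
    rw [Complex.exp_mul_I, ← Complex.ofReal_cos, ← Complex.ofReal_sin, Real.cos_sub_pi_div_two,
      Real.sin_sub_pi_div_two]
    push_cast; ring
  rw [e2, Complex.log_exp]
  · push_cast
    linear_combination ((π : ℂ) / 2 - θ) * Complex.I_sq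
  · simp only [Complex.mul_im, Complex.ofReal_re, Complex.I_im, Complex.ofReal_im, Complex.I_re]
    linarith
  · simp only [Complex.mul_im, Complex.ofReal_re, Complex.I_im, Complex.ofReal_im, Complex.I_re]
    linarith

lemma discAmp_cos (a b N τ : ℝ) {θ : ℝ} (h0 : 0 < θ) (h1 : θ < π) :
    discAmp a b N τ (Real.cos θ) = ((Real.sin (θ / 2) ^ (-a) * Real.cos (θ / 2) ^ (-b) *
      (Real.sin θ)⁻¹ * Real.cos (N * θ + τ) : ℝ) : ℂ) := by
  obtain ⟨e1, e2⟩ := complexArccos_cos h0 h1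
  have hs : 0 ≤ Real.sin (θ / 2) := Real.sin_nonneg_of_nonneg_of_le_pi (by linarith) (by linarith)
  have hc : 0 ≤ Real.cos (θ / 2) := Real.cos_nonneg_of_mem_Icc ⟨by linarith, by linarith⟩
  have hcos : Real.cos θ = 2 * Real.cos (θ / 2) ^ 2 - 1 := by
    rw [← Real.cos_two_mul]; ring_nf
  have hsc := Real.sin_sq_add_cos_sq (θ / 2)
  have e3 : (1 - (Real.cos θ : ℂ)) / 2 = ((Real.sin (θ / 2) ^ 2 : ℝ) : ℂ) := by
    rw [hcos, show Real.sin (θ / 2) ^ 2 = 1 - Real.cos (θ / 2) ^ 2 by linarith]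
    push_cast; ring
  have e4 : (1 + (Real.cos θ : ℂ)) / 2 = ((Real.cos (θ / 2) ^ 2 : ℝ) : ℂ) := by
    rw [hcos]; push_cast; ring
  have e5 : ∀ {x : ℝ} (r : ℝ), 0 ≤ x → (x ^ 2) ^ (-r / 2) = x ^ (-r) := by
    intro x r hx
    rw [← Real.rpow_natCast, ← Real.rpow_mul hx]
    congr 1; push_cast; ring
  rw [discAmp, e1, e2, e3, e4, ← Complex.ofReal_cpow (sq_nonneg _),
    ← Complex.ofReal_cpow (sq_nonneg _), e5 a hs, e5 b hc]
  push_cast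
  rfl

/-- Parametric integrals of holomorphic functions over dilations are holomorphic. -/
lemma differentiableOn_integral_dilation {w : ℝ → ℝ}
    (hw : IntervalIntegrable w volume (-1) 1) {h : ℂ → ℂ}
    (hh : DifferentiableOn ℂ h (Metric.ball 0 1)) :
    DifferentiableOn ℂ (fun c : ℂ => ∫ u in (-1 : ℝ)..1, (w u : ℂ) * h (c * u))
      (Metric.ball 0 1) := by
  intro c₀ hc₀
  rw [mem_ball_zero_iff] at hc₀
  obtain ⟨r, hr1, hr2⟩ := exists_between hc₀
  have hd : DifferentiableOn ℂ (deriv h) (Metric.ball 0 1) := hh.deriv Metric.isOpen_ball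
  have hsub : Metric.closedBall (0 : ℂ) r ⊆ Metric.ball 0 1 := Metric.closedBall_subset_ball hr2
  obtain ⟨K, hK⟩ := (isCompact_closedBall (0 : ℂ) r).exists_bound_of_continuousOn
    (hd.continuousOn.mono hsub)
  have hmem : ∀ c ∈ Metric.ball (0 : ℂ) r, ∀ u ∈ Set.uIoc (-1 : ℝ) 1,
      c * (u : ℂ) ∈ Metric.closedBall (0 : ℂ) r := by
    intro c hc u hu
    rw [Set.uIoc_of_le (by norm_num)] at hu
    rw [mem_ball_zero_iff] at hc
    rw [mem_closedBall_zero_iff, norm_mul, Complex.norm_real, Real.norm_eq_abs]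
    have : |u| ≤ 1 := abs_le.2 ⟨hu.1.le, hu.2⟩
    nlinarith [norm_nonneg c, abs_nonneg u]
  have hwC : IntervalIntegrable (fun u => (w u : ℂ)) volume (-1) 1 :=
    intervalIntegrable_ofReal hw
  have hmeas : ∀ c ∈ Metric.ball (0 : ℂ) r, ∀ g : ℂ → ℂ, ContinuousOn g (Metric.ball 0 1) →
      AEStronglyMeasurable (fun u : ℝ => g (c * u))
        (volume.restrict (Set.uIoc (-1 : ℝ) 1)) := by
    intro c hc g hg
    refine ContinuousOn.aestronglyMeasurable ?_ measurableSet_uIoc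
    exact hg.comp (by fun_prop) fun u hu => hsub (hmem c hc u hu)
  have hc₀r : c₀ ∈ Metric.ball (0 : ℂ) r := by rwa [mem_ball_zero_iff]
  obtain ⟨K', hK'⟩ := (isCompact_closedBall (0 : ℂ) r).exists_bound_of_continuousOn
    (hh.continuousOn.mono hsub)
  have key := intervalIntegral.hasDerivAt_integral_of_dominated_loc_of_deriv_le
    (μ := volume) (a := -1) (b := 1) (x₀ := c₀) (s := Metric.ball (0 : ℂ) r)
    (F := fun c u => (w u : ℂ) * h (c * u))
    (F' := fun c u => (w u : ℂ) * (deriv h (c * u) * u)) (bound := fun u => |w u| * K)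
    (Metric.isOpen_ball.mem_nhds hc₀r) ?_ ?_ ?_ ?_ ?_ ?_
  · exact key.2.differentiableAt.differentiableWithinAt
  · filter_upwards [Metric.isOpen_ball.mem_nhds hc₀r] with c hc
    exact hwC.aestronglyMeasurable_restrict_uIoc.mul (hmeas c hc h hh.continuousOn)
  · rw [intervalIntegrable_iff] at hwC ⊢
    refine Integrable.mul_bdd (c := K') hwC (hmeas c₀ hc₀r h hh.continuousOn) ?_
    filter_upwards [ae_restrict_mem measurableSet_uIoc] with u hu
    exact hK' _ (hmem c₀ hc₀r u hu)
  · refine hwC.aestronglyMeasurable_restrict_uIoc.mul ((hmeas c₀ hc₀r _ hd.continuousOn).mul ?_)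
    exact Complex.continuous_ofReal.aestronglyMeasurable
  · refine Filter.Eventually.of_forall fun u hu c hc => ?_
    rw [norm_mul, norm_mul, Complex.norm_real, Complex.norm_real, Real.norm_eq_abs,
      Real.norm_eq_abs]
    have h1 := hK _ (hmem c hc u hu)
    rw [Set.uIoc_of_le (by norm_num)] at hu
    have : |u| ≤ 1 := abs_le.2 ⟨hu.1.le, hu.2⟩
    gcongr
    exact (mul_le_of_le_one_right (norm_nonneg _) this).trans h1
  · exact hw.abs.mul_const K
  · refine Filter.Eventually.of_forall fun u hu c hc => ?_
    have h1 := (hh.differentiableAt (Metric.isOpen_ball.mem_nhds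
      (hsub (hmem c hc u hu)))).hasDerivAt
    have h2 : HasDerivAt (fun c : ℂ => c * (u : ℂ)) (u : ℂ) c := by
      simpa using (hasDerivAt_id c).mul_const (u : ℂ)
    exact (h1.comp c h2).const_mul _

lemma intervalIntegrable_one_sub_sq_rpow {mu : ℝ} (hmu : 0 < mu) :
    IntervalIntegrable (fun u : ℝ => (1 - u ^ 2) ^ (mu - 1)) volume (-1) 1 := by
  have h1 : IntervalIntegrable (fun u : ℝ => (1 - u ^ 2) ^ (mu - 1)) volume 0 1 := by
    have h2 : IntervalIntegrable (fun u : ℝ => (1 - u) ^ (mu - 1)) volume 0 1 := by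
      have := (intervalIntegral.intervalIntegrable_rpow' (a := 0) (b := 1)
        (show -1 < mu - 1 by linarith)).comp_sub_left 1
      simpa using this.symm
    have h3 : ContinuousOn (fun u : ℝ => (1 + u) ^ (mu - 1)) (Set.uIcc 0 1) := by
      refine ContinuousOn.rpow_const (by fun_prop) fun u hu => Or.inl ?_
      rw [Set.uIcc_of_le zero_le_one] at hu
      linarith [hu.1]
    refine (h2.mul_continuousOn h3).congr fun u hu => ?_
    rw [Set.uIoc_of_le zero_le_one] at hu
    rw [← Real.mul_rpow (by linarith [hu.2]) (by linarith [hu.1])]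
    ring_nf
  have h4 : IntervalIntegrable (fun u : ℝ => (1 - u ^ 2) ^ (mu - 1)) volume (-1) 0 := by
    simpa using (h1.comp_sub_left 0).symm
  exact h4.trans h1

lemma integral_dilation_discAmp (mu a b N τ : ℝ) {φ : ℝ} (h0 : 0 < φ) (h1 : φ < π / 2) :
    ∫ u in (-1 : ℝ)..1, (((1 - u ^ 2) ^ (mu - 1) : ℝ) : ℂ) *
      discAmp a b N τ (Real.cos φ * u) =
    ((Real.cos φ ^ (1 - 2 * mu) * ∫ θ in φ..(π - φ), (Real.cos φ ^ 2 - Real.cos θ ^ 2) ^ (mu - 1) *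
      Real.sin (θ / 2) ^ (-a) * Real.cos (θ / 2) ^ (-b) * Real.cos (N * θ + τ) : ℝ) : ℂ) := by
  have hc : 0 < Real.cos φ := Real.cos_pos_of_mem_Ioo ⟨by linarith, h1⟩
  have himg : (fun θ => Real.cos θ / Real.cos φ) '' Set.Ioo φ (π - φ) = Set.Ioo (-1) 1 := by
    ext u
    constructor
    · rintro ⟨θ, ⟨hθ1, hθ2⟩, rfl⟩
      have k1 := Real.cos_lt_cos_of_nonneg_of_le_pi h0.le (by linarith : θ ≤ π) hθ1
      have k2 := Real.cos_lt_cos_of_nonneg_of_le_pi (by linarith : 0 ≤ θ)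
        (by linarith : π - φ ≤ π) hθ2
      rw [Real.cos_pi_sub] at k2
      constructor
      · rw [lt_div_iff₀ hc]; linarith
      · rw [div_lt_iff₀ hc]; linarith
    · rintro ⟨hu1, hu2⟩
      have hc1 := Real.cos_le_one φ
      have k1 : Real.cos φ * u < Real.cos φ := by nlinarith
      have k2 : -Real.cos φ < Real.cos φ * u := by nlinarith
      have hcos : Real.cos (Real.arccos (Real.cos φ * u)) = Real.cos φ * u :=
        Real.cos_arccos (by linarith) (by linarith)
      refine ⟨Real.arccos (Real.cos φ * u), ⟨?_, ?_⟩, ?_⟩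
      · rw [← Real.arccos_cos h0.le (by linarith : φ ≤ π)]
        conv_rhs => rw [Real.arccos_cos h0.le (by linarith : φ ≤ π)]
        exact Real.arccos_lt_arccos (by linarith) k1 hc1
      · rw [← Real.arccos_cos (by linarith : 0 ≤ π - φ) (by linarith : π - φ ≤ π),
          Real.cos_pi_sub]
        exact Real.arccos_lt_arccos (by linarith) k2 (by linarith)
      · simp only
        rw [hcos]; field_simp
  have hinj : Set.InjOn (fun θ => Real.cos θ / Real.cos φ) (Set.Ioo φ (π - φ)) := by
    intro x hx y hy hxy
    exact Real.injOn_cos ⟨by linarith [hx.1], by linarith [hx.2]⟩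
      ⟨by linarith [hy.1], by linarith [hy.2]⟩ ((div_left_inj' hc.ne').1 hxy)
  have hderiv : ∀ θ ∈ Set.Ioo φ (π - φ), HasDerivWithinAt (fun θ => Real.cos θ / Real.cos φ)
      (-Real.sin θ / Real.cos φ) (Set.Ioo φ (π - φ)) θ := fun θ _ =>
    ((Real.hasDerivAt_cos θ).div_const _).hasDerivWithinAt
  rw [intervalIntegral.integral_of_le (by norm_num), integral_Ioc_eq_integral_Ioo, ← himg,
    integral_image_eq_integral_abs_deriv_smul measurableSet_Ioo hderiv hinj,
    ← intervalIntegral.integral_const_mul, intervalIntegral.integral_of_le (by linarith),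
    integral_Ioc_eq_integral_Ioo, ← integral_complex_ofReal]
  refine setIntegral_congr_fun measurableSet_Ioo fun θ hθ => ?_
  have hs := Real.sin_pos_of_pos_of_lt_pi (by linarith [hθ.1] : 0 < θ) (by linarith [hθ.2])
  have k0 : (Real.cos φ : ℂ) * ((Real.cos θ / Real.cos φ : ℝ) : ℂ) = (Real.cos θ : ℂ) := by
    rw [← Complex.ofReal_mul, mul_div_cancel₀ _ hc.ne']
  have k1 : 0 ≤ Real.cos φ ^ 2 - Real.cos θ ^ 2 := by
    have m1 := Real.cos_lt_cos_of_nonneg_of_le_pi h0.le (by linarith [hθ.2] : θ ≤ π) hθ.1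
    have m2 := Real.cos_lt_cos_of_nonneg_of_le_pi (by linarith [hθ.1] : 0 ≤ θ)
        (by linarith : π - φ ≤ π) hθ.2
    rw [Real.cos_pi_sub] at m2
    nlinarith
  have k2 : (1 - (Real.cos θ / Real.cos φ) ^ 2) ^ (mu - 1) =
      (Real.cos φ ^ 2 - Real.cos θ ^ 2) ^ (mu - 1) * Real.cos φ ^ (2 - 2 * mu) := by
    rw [show 1 - (Real.cos θ / Real.cos φ) ^ 2 = (Real.cos φ ^ 2 - Real.cos θ ^ 2) /
      Real.cos φ ^ 2 by field_simp, Real.div_rpow k1 (sq_nonneg _), div_eq_mul_inv,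
      ← Real.rpow_natCast, ← Real.rpow_mul hc.le, ← Real.rpow_neg hc.le]
    congr 2
    push_cast; ring
  have k3 : Real.cos φ ^ (2 - 2 * mu) = Real.cos φ ^ (1 - 2 * mu) * Real.cos φ := by
    rw [← Real.rpow_add_one hc.ne']; ring_nf
  rw [k0, discAmp_cos a b N τ (by linarith [hθ.1]) (by linarith [hθ.2]), k2, k3,
    ← Complex.ofReal_mul, abs_div, abs_neg, abs_of_pos hs, abs_of_pos hc, Complex.real_smul,
    ← Complex.ofReal_mul]
  refine congrArg _ ?_
  field_simp

lemma cos_mul_add_eq_of_discAmp_add_neg {a b N τ : ℝ} {θ : ℝ} (h0 : 0 < θ) (h1 : θ < π)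
    (h : discAmp a b N τ (Real.cos θ) + discAmp a b N τ (-Real.cos θ) = 0) :
    Real.cos (N * θ + τ) =
      -(Real.tan (θ / 2) ^ (a - b) * Real.cos (N * (π - θ) + τ)) := by
  have hs : 0 < Real.sin (θ / 2) := Real.sin_pos_of_pos_of_lt_pi (by linarith) (by linarith)
  have hc : 0 < Real.cos (θ / 2) := Real.cos_pos_of_mem_Ioo ⟨by linarith, by linarith⟩
  have hs' := Real.sin_pos_of_pos_of_lt_pi h0 h1
  rw [← Complex.ofReal_neg, ← Real.cos_pi_sub, discAmp_cos a b N τ h0 h1,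
    discAmp_cos a b N τ (by linarith) (by linarith), ← Complex.ofReal_add,
    Complex.ofReal_eq_zero, Real.sin_pi_sub, show (π - θ) / 2 = π / 2 - θ / 2 by ring,
    Real.sin_pi_div_two_sub, Real.cos_pi_div_two_sub] at h
  have h2 : Real.sin (θ / 2) ^ (-a) * Real.cos (θ / 2) ^ (-b) * Real.cos (N * θ + τ) +
      Real.cos (θ / 2) ^ (-a) * Real.sin (θ / 2) ^ (-b) * Real.cos (N * (π - θ) + τ) = 0 := by
    have := congrArg (fun x => x * Real.sin θ) h
    simp only [zero_mul] at this
    rw [← this]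
    field_simp
  rw [Real.tan_eq_sin_div_cos, Real.div_rpow hs.le hc.le, Real.rpow_sub hs, Real.rpow_sub hc]
  rw [Real.rpow_neg hs.le, Real.rpow_neg hs.le, Real.rpow_neg hc.le, Real.rpow_neg hc.le] at h2
  have p1 := Real.rpow_pos_of_pos hs a
  have p2 := Real.rpow_pos_of_pos hs b
  have p3 := Real.rpow_pos_of_pos hc a
  have p4 := Real.rpow_pos_of_pos hc b
  field_simp at h2 ⊢
  linarith

lemma not_forall_cos_mul_add_eq {N τ q : ℝ} (hN : 1 < N) (hq : 0 < q)
    (h : ∀ θ, 0 < θ → θ < π → Real.cos (N * θ + τ) =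
      -(Real.tan (θ / 2) ^ q * Real.cos (N * (π - θ) + τ))) : False := by
  have hpi := Real.pi_pos
  have hτ : Real.cos τ = 0 := by
    have c1 : Continuous fun θ : ℝ => Real.cos (N * θ + τ) := by fun_prop
    have t1 : Filter.Tendsto (fun θ : ℝ => Real.cos (N * θ + τ)) (nhdsWithin 0 (Set.Ioi 0))
        (nhds (Real.cos τ)) := by
      have := (c1.tendsto 0).mono_left (nhdsWithin_le_nhds (s := Set.Ioi 0))
      simpa using this
    have c2 : ContinuousAt (fun θ : ℝ => -(Real.tan (θ / 2) ^ q * Real.cos (N * (π - θ) + τ)))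
        0 := by
      have : ContinuousAt (fun θ : ℝ => Real.tan (θ / 2)) 0 :=
        ContinuousAt.comp (g := Real.tan)
          (Real.continuousAt_tan.2 (by simp)) (by fun_prop)
      exact ((this.rpow_const (Or.inr hq.le)).mul (by fun_prop)).neg
    have t2 : Filter.Tendsto (fun θ : ℝ => -(Real.tan (θ / 2) ^ q * Real.cos (N * (π - θ) + τ)))
        (nhdsWithin 0 (Set.Ioi 0)) (nhds 0) := by
      have := c2.tendsto.mono_left (nhdsWithin_le_nhds (s := Set.Ioi 0))
      simpa [Real.zero_rpow hq.ne'] using this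
    refine tendsto_nhds_unique (t1.congr' ?_) t2
    filter_upwards [Ioo_mem_nhdsGT hpi] with θ hθ
    exact h θ hθ.1 hθ.2
  have hN0 : 0 < N := by linarith
  have hlt : π / N < π := div_lt_self hpi hN
  have h1 := h (π / N) (by positivity) hlt
  have h2 := h (π / (2 * N)) (by positivity)
    ((div_lt_div_of_pos_left hpi hN0 (by linarith)).trans hlt)
  rw [show N * (π / N) + τ = τ + π by field_simp; ring, Real.cos_add_pi, hτ,
    show N * (π - π / N) + τ = N * π + τ - π by field_simp; ring, Real.cos_sub_pi] at h1
  rw [show N * (π / (2 * N)) + τ = τ + π / 2 by field_simp; ring, Real.cos_add_pi_div_two,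
    show N * (π - π / (2 * N)) + τ = N * π + τ - π / 2 by field_simp; ring,
    Real.cos_sub_pi_div_two] at h2
  have p1 : 0 < Real.tan (π / N / 2) := Real.tan_pos_of_pos_of_lt_pi_div_two (by positivity)
    (by linarith)
  have hcos : Real.cos (N * π + τ) = 0 := by
    have := Real.rpow_pos_of_pos p1 q
    have h3 : Real.tan (π / N / 2) ^ q * Real.cos (N * π + τ) = 0 := by linarith
    exact (mul_eq_zero.1 h3).resolve_left this.ne'
  have s1 := Real.sin_sq_add_cos_sq τ
  have s2 := Real.sin_sq_add_cos_sq (N * π + τ)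
  rw [hτ] at s1
  rw [hcos] at s2
  have hx : π / (2 * N) / 2 < π / 4 := by
    rw [div_div, div_lt_div_iff₀ (by positivity) (by norm_num)]
    nlinarith
  have p2 : 0 < Real.tan (π / (2 * N) / 2) :=
    Real.tan_pos_of_pos_of_lt_pi_div_two (by positivity) (by linarith)
  have p3 : Real.tan (π / (2 * N) / 2) < 1 := by
    rw [← Real.tan_pi_div_four]
    have : 0 < π / (2 * N) / 2 := by positivity
    exact Real.tan_lt_tan_of_lt_of_lt_pi_div_two (by linarith) (by linarith) hx
  have p4 := Real.rpow_lt_one p2.le p3 hq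
  have p5 := Real.rpow_pos_of_pos p2 q
  set T := Real.tan (π / (2 * N) / 2) ^ q
  have h4 : Real.sin τ ^ 2 = T ^ 2 * Real.sin (N * π + τ) ^ 2 := by
    rw [← mul_pow, ← neg_sq (Real.sin τ), h2, neg_sq]
  nlinarith

lemma add_neg_eq_zero_of_forall_integral_dilation_eq_zero {w : ℝ → ℝ}
    (hw : IntervalIntegrable w volume (-1) 1) (hwpos : ∀ u ∈ Set.Ioo (0 : ℝ) 1, 0 < w u)
    (hweven : ∀ u, w (-u) = w u) {h : ℂ → ℂ} (hh : DifferentiableOn ℂ h (Metric.ball 0 1))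
    (hreal : ∀ y : ℝ, |y| < 1 → (h y).im = 0)
    (hzero : ∀ c ∈ Metric.ball (0 : ℂ) 1, ∫ u in (-1 : ℝ)..1, (w u : ℂ) * h (c * u) = 0) :
    ∀ y ∈ Metric.ball (0 : ℂ) 1, h y + h (-y) = 0 := by
  set H : ℂ → ℂ := fun y => h y + h (-y) with hH
  have hneg : ∀ y ∈ Metric.ball (0 : ℂ) 1, -y ∈ Metric.ball (0 : ℂ) 1 := by
    intro y hy
    rwa [mem_ball_zero_iff, norm_neg, ← mem_ball_zero_iff]
  have hHd : DifferentiableOn ℂ H (Metric.ball 0 1) :=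
    hh.add (hh.comp (differentiable_neg.differentiableOn) hneg)
  have hHa := hHd.analyticOnNhd Metric.isOpen_ball
  have h0 : (0 : ℂ) ∈ Metric.ball (0 : ℂ) 1 := by simp
  rcases (hHa 0 h0).eventually_eq_zero_or_eventually_ne_zero with h1 | h1
  · exact fun y hy => hHa.eqOn_zero_of_preconnected_of_eventuallyEq_zero
      (convex_ball _ _).isPreconnected h0 h1 hy
  exfalso
  rw [eventually_nhdsWithin_iff, Metric.eventually_nhds_iff] at h1
  obtain ⟨ε, hε, h1⟩ := h1
  obtain ⟨c, hc0, hc⟩ := exists_between (lt_min hε one_pos)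
  rw [lt_min_iff] at hc
  have hcball : ∀ u : ℝ, |u| ≤ 1 → (c : ℂ) * u ∈ Metric.ball (0 : ℂ) 1 := by
    intro u hu
    rw [mem_ball_zero_iff, ← Complex.ofReal_mul, Complex.norm_real, Real.norm_eq_abs, abs_mul,
      abs_of_pos hc0]
    nlinarith [abs_nonneg u]
  have hInt : ∀ s : ℝ, |s| ≤ 1 → IntervalIntegrable (fun u => (w u : ℂ) * h (c * (s * u : ℝ)))
      volume 0 1 := by
    intro s hs
    refine (intervalIntegrable_ofReal (hw.mono_set ?_)).mul_continuousOn ?_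
    · rw [Set.uIcc_of_le (by norm_num), Set.uIcc_of_le (by norm_num)]
      exact Set.Icc_subset_Icc_left (by norm_num)
    · refine hh.continuousOn.comp (by fun_prop) fun u hu => hcball _ ?_
      rw [Set.uIcc_of_le zero_le_one] at hu
      rw [abs_mul, abs_of_nonneg hu.1]
      nlinarith [hu.1, hu.2, abs_nonneg s]
  have hint1 := hInt 1 (by simp)
  have hint2 := hInt (-1) (by simp)
  simp only [one_mul, neg_mul] at hint1 hint2
  have hHr : ∀ u ∈ Set.Ioo (0 : ℝ) 1, ((H (c * u)).re : ℂ) = H (c * u) := by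
    intro u hu
    have e1 : |c * u| < 1 := by
      rw [abs_of_pos (mul_pos hc0 hu.1)]; nlinarith [hu.1, hu.2]
    refine Complex.ext rfl ?_
    have i1 := hreal (c * u) e1
    have i2 := hreal (-(c * u)) (by rwa [abs_neg])
    push_cast at i1 i2
    simp only [hH, Complex.ofReal_im, Complex.add_im, i1, i2, add_zero]
  have hsum : ∫ u in (0 : ℝ)..1, w u * (H (c * u)).re = 0 := by
    have hz := hzero c (by simpa using hcball 1 (by simp))
    have hl : IntervalIntegrable (fun u : ℝ => (w u : ℂ) * h (c * u)) volume (-1) 0 := by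
      have := (hint2.comp_sub_left 0).symm
      simpa [hweven] using this
    rw [← intervalIntegral.integral_add_adjacent_intervals hl hint1] at hz
    have hl2 : ∫ u in (-1 : ℝ)..0, (w u : ℂ) * h (c * u) =
        ∫ u in (0 : ℝ)..1, (w u : ℂ) * h (c * ((-u : ℝ) : ℂ)) := by
      have := intervalIntegral.integral_comp_neg (a := 0) (b := 1)
        (fun u : ℝ => (w u : ℂ) * h (c * u))
      simp only [hweven, neg_zero] at this
      exact this.symm
    rw [hl2, ← intervalIntegral.integral_add hint2 hint1] at hz
    rw [← Complex.ofReal_eq_zero, ← intervalIntegral.integral_ofReal, ← hz,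
      intervalIntegral.integral_of_le zero_le_one, intervalIntegral.integral_of_le zero_le_one,
      integral_Ioc_eq_integral_Ioo, integral_Ioc_eq_integral_Ioo]
    refine setIntegral_congr_fun measurableSet_Ioo fun u hu => ?_
    have := hHr u hu
    simp only [Complex.ofReal_mul, this]
    simp only [hH]
    push_cast
    ring_nf
  have hcont : ContinuousOn (fun u : ℝ => (H (c * u)).re) (Set.Icc 0 1) := by
    refine Complex.continuous_re.comp_continuousOn
      (hHd.continuousOn.comp (by fun_prop) fun u hu => hcball u ?_)
    rw [abs_of_nonneg hu.1]; exact hu.2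
  have hne : ∀ u ∈ Set.Ioo (0 : ℝ) 1, (H (c * u)).re ≠ 0 := by
    intro u hu h2
    have h3 := hHr u hu
    rw [h2] at h3
    refine h1 (y := c * u) ?_ ?_ h3.symm
    · rw [dist_zero_right, ← Complex.ofReal_mul, Complex.norm_real, Real.norm_eq_abs,
        abs_of_pos (mul_pos hc0 hu.1)]
      nlinarith [hu.1, hu.2]
    · simp [hc0.ne', hu.1.ne']
  have hint3 : IntervalIntegrable (fun u => w u * (H (c * u)).re) volume 0 1 := by
    refine (hw.mono_set ?_).mul_continuousOn ?_
    · rw [Set.uIcc_of_le (by norm_num), Set.uIcc_of_le (by norm_num)]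
      exact Set.Icc_subset_Icc_left (by norm_num)
    · rwa [Set.uIcc_of_le zero_le_one]
  have hsign : (∀ u ∈ Set.Ioo (0 : ℝ) 1, 0 < (H (c * u)).re) ∨
      (∀ u ∈ Set.Ioo (0 : ℝ) 1, (H (c * u)).re < 0) := by
    by_contra hcon
    push Not at hcon
    obtain ⟨⟨u₁, hu₁, k₁⟩, u₂, hu₂, k₂⟩ := hcon
    obtain ⟨u, hu, hu'⟩ := isPreconnected_Ioo.intermediate_value hu₁ hu₂
      (hcont.mono Set.Ioo_subset_Icc_self) ⟨k₁, k₂⟩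
    exact hne u hu hu'
  rcases hsign with h2 | h2
  · have := intervalIntegral.intervalIntegral_pos_of_pos_on hint3
      (fun u hu => mul_pos (hwpos u hu) (h2 u hu)) one_pos
    linarith
  · have := intervalIntegral.intervalIntegral_pos_of_pos_on hint3.neg
      (fun u hu => neg_pos.2 (mul_neg_of_pos_of_neg (hwpos u hu) (h2 u hu))) one_pos
    simp only [Pi.neg_apply, intervalIntegral.integral_neg] at this
    linarith

/-- The oscillatory integral as a holomorphic function of `cos φ`, up to a power. -/
noncomputable def discMosc (lam mu δ : ℝ) (n : ℕ) (c : ℂ) : ℂ :=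
  ∫ u in (-1 : ℝ)..1, (((1 - u ^ 2) ^ (mu - 1) : ℝ) : ℂ) *
    discAmp (lam + mu + δ) (lam + mu - 1)
      ((n : ℝ) + ((lam + mu + δ) + (lam + mu - 1)) / 2 + 1)
      (-(Real.pi * ((lam + mu + δ) + 1) / 2)) (c * u)

lemma discMosc_cos (lam mu δ : ℝ) (n : ℕ) {φ : ℝ} (h0 : 0 < φ) (h1 : φ < π / 2) :
    discMosc lam mu δ n (Real.cos φ) =
      ((Real.cos φ ^ (1 - 2 * mu) * Mosc lam mu δ n φ : ℝ) : ℂ) :=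
  integral_dilation_discAmp _ _ _ _ _ h0 h1

lemma differentiableOn_discMosc (lam δ : ℝ) {mu : ℝ} (hmu1 : 0 < mu) (n : ℕ) :
    DifferentiableOn ℂ (discMosc lam mu δ n) (Metric.ball 0 1) :=
  differentiableOn_integral_dilation (intervalIntegrable_one_sub_sq_rpow hmu1)
    (differentiableOn_discAmp _ _ _ _)

lemma norm_cos_lt_one {φ : ℝ} (h0 : 0 < φ) (h1 : φ < π / 2) : ‖(Real.cos φ : ℂ)‖ < 1 := by
  rw [Complex.norm_real, Real.norm_eq_abs,
    abs_of_pos (Real.cos_pos_of_mem_Ioo ⟨by linarith, h1⟩)]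
  have := Real.cos_lt_cos_of_nonneg_of_le_pi le_rfl (by linarith) h0
  rwa [Real.cos_zero] at this

lemma continuousOn_Mosc (lam δ : ℝ) {mu : ℝ} (hmu1 : 0 < mu) (n : ℕ) :
    ContinuousOn (Mosc lam mu δ n) (Set.Ioo 0 (π / 2)) := by
  have hcos : ∀ φ ∈ Set.Ioo 0 (π / 2), 0 < Real.cos φ := fun φ hφ =>
    Real.cos_pos_of_mem_Ioo ⟨by linarith [hφ.1, hφ.2], hφ.2⟩
  have h1 : ContinuousOn (fun φ : ℝ => Real.cos φ ^ (2 * mu - 1) *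
      (discMosc lam mu δ n (Real.cos φ)).re) (Set.Ioo 0 (π / 2)) := by
    refine ContinuousOn.mul (ContinuousOn.rpow_const (by fun_prop) fun φ hφ => Or.inl
      (hcos φ hφ).ne') ?_
    refine Complex.continuous_re.comp_continuousOn
      ((differentiableOn_discMosc lam δ hmu1 n).continuousOn.comp (by fun_prop) fun φ hφ => ?_)
    rw [mem_ball_zero_iff]
    exact norm_cos_lt_one hφ.1 hφ.2
  refine h1.congr fun φ hφ => ?_
  simp only
  rw [discMosc_cos lam mu δ n hφ.1 hφ.2, Complex.ofReal_re, ← mul_assoc,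
    ← Real.rpow_add (hcos φ hφ)]
  ring_nf
  rw [Real.rpow_zero, one_mul]

lemma exists_Mosc_ne_zero {lam mu δ : ℝ} (hmu1 : 0 < mu) (hlam : 0 ≤ lam) (hδ1 : -1 < δ)
    {n : ℕ} (hn : 2 ≤ n) {x y : ℝ} (hx : 0 < x) (hxy : x < y) (hy : y < π / 2) :
    ∃ φ ∈ Set.Icc x y, Mosc lam mu δ n φ ≠ 0 := by
  by_contra hcon
  push Not at hcon
  have hF := (differentiableOn_discMosc lam δ hmu1 n).analyticOnNhd Metric.isOpen_ball
  obtain ⟨φ₀, hφ₀x, hφ₀y⟩ := exists_between hxy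
  have hmem : (Real.cos φ₀ : ℂ) ∈ Metric.ball (0 : ℂ) 1 := by
    rw [mem_ball_zero_iff]
    exact norm_cos_lt_one (by linarith) (by linarith)
  have htend : Filter.Tendsto (fun φ : ℝ => (Real.cos φ : ℂ)) (nhdsWithin φ₀ (Set.Ioi φ₀))
      (nhdsWithin (Real.cos φ₀ : ℂ) {(Real.cos φ₀ : ℂ)}ᶜ) := by
    refine tendsto_nhdsWithin_iff.2 ⟨?_, ?_⟩
    · have : Continuous fun φ : ℝ => (Real.cos φ : ℂ) := by fun_prop
      exact (this.tendsto φ₀).mono_left nhdsWithin_le_nhds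
    · filter_upwards [Ioo_mem_nhdsGT hφ₀y] with φ hφ
      have := Real.cos_lt_cos_of_nonneg_of_le_pi (by linarith : 0 ≤ φ₀)
        (by linarith [hφ.2, Real.pi_pos] : φ ≤ π) hφ.1
      simp only [Set.mem_compl_iff, Set.mem_singleton_iff, Complex.ofReal_inj]
      exact this.ne
  have hfreq : ∃ᶠ z in nhdsWithin (Real.cos φ₀ : ℂ) {(Real.cos φ₀ : ℂ)}ᶜ,
      discMosc lam mu δ n z = 0 := by
    refine htend.frequently (Filter.Eventually.frequently ?_)
    filter_upwards [Ioo_mem_nhdsGT hφ₀y] with φ hφ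
    rw [discMosc_cos lam mu δ n (by linarith [hφ.1]) (by linarith [hφ.2]),
      hcon φ ⟨by linarith [hφ.1], hφ.2.le⟩, mul_zero, Complex.ofReal_zero]
  have hzero := hF.eqOn_zero_of_preconnected_of_frequently_eq_zero
    (convex_ball _ _).isPreconnected hmem hfreq
  have hodd := add_neg_eq_zero_of_forall_integral_dilation_eq_zero
    (intervalIntegrable_one_sub_sq_rpow hmu1)
    (fun u hu => Real.rpow_pos_of_pos (by nlinarith [hu.1, hu.2]) _) (fun u => by simp)
    (differentiableOn_discAmp _ _ _ _) (fun y hy => ?_) hzero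
  · have hn' : (2 : ℝ) ≤ n := by exact_mod_cast hn
    refine not_forall_cos_mul_add_eq (q := (lam + mu + δ) - (lam + mu - 1)) (by linarith)
      (by linarith) fun θ h0 h1 => cos_mul_add_eq_of_discAmp_add_neg h0 h1 (hodd _ ?_)
    rw [mem_ball_zero_iff, Complex.norm_real, Real.norm_eq_abs, abs_lt]
    have k1 := Real.cos_lt_cos_of_nonneg_of_le_pi le_rfl h1.le h0
    have k2 := Real.cos_lt_cos_of_nonneg_of_le_pi h0.le le_rfl h1
    rw [Real.cos_zero] at k1
    rw [Real.cos_pi] at k2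
    exact ⟨k2, k1⟩
  · rw [abs_lt] at hy
    rw [← Real.cos_arccos hy.1.le hy.2.le, discAmp_cos _ _ _ _ (Real.arccos_pos.2 hy.2)
      (Real.arccos_lt_pi.2 hy.1), Complex.ofReal_im]

lemma continuousOn_abs_Mosc_mul (lam δ : ℝ) {mu : ℝ} (hmu1 : 0 < mu) (n : ℕ) :
    ContinuousOn (fun φ => |Mosc lam mu δ n φ| * Real.sin φ ^ (2 * lam))
      (Set.Ioo 0 (π / 2)) := by
  refine ContinuousOn.mul (continuousOn_Mosc lam δ hmu1 n).abs
    (ContinuousOn.rpow_const (by fun_prop) fun φ hφ => Or.inl ?_)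
  exact (Real.sin_pos_of_pos_of_lt_pi hφ.1 (by linarith [hφ.1, hφ.2])).ne'

lemma integral_abs_Mosc_mul_pos {lam mu δ : ℝ} (hmu1 : 0 < mu) (hlam : 0 ≤ lam) (hδ1 : -1 < δ)
    {n : ℕ} (hn : 2 ≤ n) :
    0 < ∫ φ in ((n : ℝ)⁻¹)..(π / 4), |Mosc lam mu δ n φ| * Real.sin φ ^ (2 * lam) := by
  have hn' : (2 : ℝ) ≤ n := by exact_mod_cast hn
  have hn0 : 0 < (n : ℝ)⁻¹ := by positivity
  have hlt : (n : ℝ)⁻¹ < π / 4 := by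
    have : (n : ℝ)⁻¹ ≤ 2⁻¹ := inv_anti₀ (by norm_num) hn'
    linarith [Real.pi_gt_three]
  have hpi := Real.pi_pos
  obtain ⟨φ, hφ, hφ'⟩ := exists_Mosc_ne_zero hmu1 hlam hδ1 hn hn0 hlt (by linarith)
  refine intervalIntegral.integral_pos hlt ((continuousOn_abs_Mosc_mul lam δ hmu1 n).mono
    fun x hx => ⟨by linarith [hx.1], by linarith [hx.2]⟩) (fun x hx => ?_) ⟨φ, hφ, ?_⟩
  · exact mul_nonneg (abs_nonneg _) (Real.rpow_nonneg (Real.sin_nonneg_of_nonneg_of_le_pi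
      (by linarith [hx.1]) (by linarith [hx.2])) _)
  · exact mul_pos (abs_pos.2 hφ') (Real.rpow_pos_of_pos (Real.sin_pos_of_pos_of_lt_pi
      (by linarith [hφ.1]) (by linarith [hφ.2])) _)

lemma intervalIntegrable_abs_Mosc_mul (lam δ : ℝ) {mu : ℝ} (hmu1 : 0 < mu) (n : ℕ) {x y : ℝ}
    (hx : 0 < x) (hxy : x ≤ y) (hy : y ≤ π / 4) :
    IntervalIntegrable (fun φ => |Mosc lam mu δ n φ| * Real.sin φ ^ (2 * lam)) volume x y := by
  refine ((continuousOn_abs_Mosc_mul lam δ hmu1 n).mono fun t ht => ?_).intervalIntegrable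
  rw [Set.uIcc_of_le hxy] at ht
  exact ⟨by linarith [ht.1], by linarith [ht.2, Real.pi_pos]⟩

lemma abs_Mosc_mul_nonneg (lam mu δ : ℝ) (n : ℕ) {φ : ℝ} (h0 : 0 < φ) (h1 : φ ≤ π / 4) :
    0 ≤ |Mosc lam mu δ n φ| * Real.sin φ ^ (2 * lam) :=
  mul_nonneg (abs_nonneg _) (Real.rpow_nonneg (Real.sin_nonneg_of_nonneg_of_le_pi
      h0.le (by linarith [Real.pi_pos])) _)

lemma hasDerivAt_log_add_osc (c C β : ℝ) {N mu δ φ : ℝ} (hN : 0 < N) (hmu2 : mu < 1)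
    (hδ1 : -1 < δ) (hφ : 0 < φ) :
    HasDerivAt (fun φ => c / 2 * Real.log φ +
        c / (4 * N) * ((1 + Real.sin (2 * (N * φ + β))) * φ⁻¹) -
        C / (δ + 1) * φ ^ (δ + 1) + C * N ^ (mu - 1) / (1 - mu) * φ ^ (mu - 1))
      (φ⁻¹ * (c * Real.cos (N * φ + β) ^ 2 - C * φ ^ (δ + 1) - C * (N * φ) ^ (mu - 1)) -
        c / (4 * N) * ((1 + Real.sin (2 * (N * φ + β))) * (φ⁻¹) ^ 2)) φ := by
  have d1 := (Real.hasDerivAt_log hφ.ne').const_mul (c / 2)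
  have d2 : HasDerivAt (fun φ : ℝ => 1 + Real.sin (2 * (N * φ + β)))
      (Real.cos (2 * (N * φ + β)) * (2 * N)) φ := by
    have : HasDerivAt (fun φ : ℝ => 2 * (N * φ + β)) (2 * N) φ := by
      simpa using (((hasDerivAt_id φ).const_mul N).add_const β).const_mul 2
    exact this.sin.const_add 1
  have d3 := (d2.mul (hasDerivAt_inv hφ.ne')).const_mul (c / (4 * N))
  have d4 := (Real.hasDerivAt_rpow_const (p := δ + 1) (Or.inl hφ.ne')).const_mul (C / (δ + 1))
  have d5 := (Real.hasDerivAt_rpow_const (p := mu - 1) (Or.inl hφ.ne')).const_mul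
    (C * N ^ (mu - 1) / (1 - mu))
  refine (((d1.add d3).sub d4).add d5).congr_deriv ?_
  have h1 : δ + 1 ≠ 0 := by linarith
  have h2 : 1 - mu ≠ 0 := by linarith
  rw [Real.cos_two_mul, Real.mul_rpow hN.le hφ.le, Real.rpow_sub_one hφ.ne' (mu - 1),
    Real.rpow_sub_one hφ.ne' (δ + 1), inv_pow]
  field_simp
  ring

lemma exists_integral_abs_Mosc_lower_bound (lam mu δ : ℝ) (hmu1 : 0 < mu) (hmu2 : mu < 1)
    (hlam : 0 ≤ lam) (hδ1 : -1 < δ) (hδ2 : δ ≤ lam) :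
    ∃ c C : ℝ, 0 < c ∧ 0 < C ∧ ∀ (n : ℕ) (N x y : ℝ), N = n + (lam + mu + δ / 2 + 1 / 2) →
      0 < x → x ≤ y → y ≤ π / 4 → 1 ≤ N * x →
      N ^ (-mu) * (x ^ (lam - δ) * (c * Real.log (y / x) - C * y ^ (δ + 1) -
        C * (N * x) ^ (mu - 1))) ≤
        ∫ φ in x..y, |Mosc lam mu δ n φ| * Real.sin φ ^ (2 * lam) := by
  obtain ⟨c, C, β, hc, hC, h⟩ := exists_Mosc_lower_bound lam mu δ hmu1 hmu2 hlam hδ1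
  have hδ : 0 < δ + 1 := by linarith
  have hmu : 0 < 1 - mu := by linarith
  refine ⟨c / 2, c / 2 + C / (δ + 1) + C / (1 - mu), by positivity, by positivity,
    fun n N x y hN hx hxy hy hNx => ?_⟩
  have hN0 : 0 < N := by
    by_contra hneg
    push Not at hneg
    nlinarith
  have hpos : ∀ t ∈ Set.uIcc x y, 0 < t := fun t ht => by
    rw [Set.uIcc_of_le hxy] at ht; linarith [ht.1]
  set ψ : ℝ → ℝ := fun φ =>
    φ⁻¹ * (c * Real.cos (N * φ + β) ^ 2 - C * φ ^ (δ + 1) - C * (N * φ) ^ (mu - 1)) -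
        c / (4 * N) * ((1 + Real.sin (2 * (N * φ + β))) * (φ⁻¹) ^ 2) with hψ
  have hψi : IntervalIntegrable ψ volume x y := by
    refine ContinuousOn.intervalIntegrable fun t ht => ContinuousAt.continuousWithinAt ?_
    have ht := hpos t ht
    have c1 : ContinuousAt (fun φ : ℝ => φ⁻¹) t := continuousAt_inv₀ ht.ne'
    have c2 : ContinuousAt (fun φ : ℝ => φ ^ (δ + 1)) t :=
      Real.continuousAt_rpow_const _ _ (Or.inl ht.ne')
    have c3 : ContinuousAt (fun φ : ℝ => (N * φ) ^ (mu - 1)) t :=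
      ContinuousAt.rpow_const (by fun_prop) (Or.inl (mul_pos hN0 ht).ne')
    fun_prop
  have hFTC := intervalIntegral.integral_eq_sub_of_hasDerivAt
    (fun t ht => hasDerivAt_log_add_osc c C β hN0 hmu2 hδ1 (hpos t ht)) hψi
  have hpt : ∀ t ∈ Set.Icc x y, N ^ (-mu) * x ^ (lam - δ) * ψ t ≤
      |Mosc lam mu δ n t| * Real.sin t ^ (2 * lam) := by
    intro t ht
    have ht0 : 0 < t := by linarith [ht.1]
    have ht1 : t ≤ π / 4 := by linarith [ht.2]
    have h1 := h n N t hN ht0 ht1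
    have h2 := abs_Mosc_mul_nonneg lam mu δ n ht0 ht1
    set Y := c * Real.cos (N * t + β) ^ 2 - C * t ^ (δ + 1) - C * (N * t) ^ (mu - 1) with hY
    have h3 : ψ t ≤ t⁻¹ * Y := by
      have := Real.neg_one_le_sin (2 * (N * t + β))
      have : 0 ≤ c / (4 * N) * ((1 + Real.sin (2 * (N * t + β))) * (t⁻¹) ^ 2) := by
        have : 0 ≤ 1 + Real.sin (2 * (N * t + β)) := by linarith
        positivity
      simp only [hψ, ← hY]
      linarith
    have hF : 0 < N ^ (-mu) := Real.rpow_pos_of_pos hN0 _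
    have hxp : 0 < x ^ (lam - δ) := Real.rpow_pos_of_pos hx _
    refine (mul_le_mul_of_nonneg_left h3 (by positivity)).trans ?_
    rcases le_total Y 0 with hY0 | hY0
    · have : t⁻¹ * Y ≤ 0 := mul_nonpos_of_nonneg_of_nonpos (by positivity) hY0
      exact (mul_nonpos_of_nonneg_of_nonpos (by positivity) this).trans h2
    · refine le_trans ?_ h1
      rw [Real.rpow_sub_one ht0.ne', mul_assoc, div_eq_mul_inv, mul_assoc]
      have : x ^ (lam - δ) ≤ t ^ (lam - δ) :=
        Real.rpow_le_rpow hx.le ht.1 (by linarith)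
      gcongr
  have hmono := intervalIntegral.integral_mono_on hxy (hψi.const_mul _)
    (intervalIntegrable_abs_Mosc_mul lam δ hmu1 n hx hxy hy) hpt
  rw [intervalIntegral.integral_const_mul, hFTC, mul_assoc] at hmono
  refine le_trans ?_ hmono
  have hy0 : 0 < y := by linarith
  refine mul_le_mul_of_nonneg_left (mul_le_mul_of_nonneg_left ?_ (Real.rpow_nonneg hx.le _))
    (Real.rpow_nonneg hN0.le _)
  rw [Real.log_div hy0.ne' hx.ne']
  have b1 : 0 ≤ c / (4 * N) * ((1 + Real.sin (2 * (N * y + β))) * y⁻¹) := by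
    have := Real.neg_one_le_sin (2 * (N * y + β))
    have : 0 ≤ 1 + Real.sin (2 * (N * y + β)) := by linarith
    positivity
  have b2 : c / (4 * N) * ((1 + Real.sin (2 * (N * x + β))) * x⁻¹) ≤
      c / 2 * (N * x) ^ (mu - 1) := by
    have := Real.sin_le_one (2 * (N * x + β))
    calc c / (4 * N) * ((1 + Real.sin (2 * (N * x + β))) * x⁻¹)
        ≤ c / (4 * N) * (2 * x⁻¹) := by gcongr; linarith
      _ = c / 2 * (N * x) ^ (-1 : ℝ) := by rw [Real.rpow_neg_one]; field_simp; norm_num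
      _ ≤ _ := by
        refine mul_le_mul_of_nonneg_left ?_ (by positivity)
        exact Real.rpow_le_rpow_of_exponent_le hNx (by linarith)
  have b3 : C * N ^ (mu - 1) / (1 - mu) * x ^ (mu - 1) =
      C / (1 - mu) * (N * x) ^ (mu - 1) := by
    rw [Real.mul_rpow hN0.le hx.le]; ring
  have b4 : 0 ≤ C * N ^ (mu - 1) / (1 - mu) * y ^ (mu - 1) := by positivity
  have b5 : 0 ≤ C / (δ + 1) * x ^ (δ + 1) := by positivity
  have b6 : 0 ≤ (c / 2 + C / (1 - mu)) * y ^ (δ + 1) := by positivity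
  have b7 : 0 ≤ C / (δ + 1) * (N * x) ^ (mu - 1) := by positivity
  linarith

lemma eventually_integral_abs_Mosc_lower_bound (lam mu δ : ℝ) (hmu1 : 0 < mu) (hmu2 : mu < 1)
    (hlam : 0 ≤ lam) (hδ1 : -1 < δ) (hδ2 : δ ≤ lam) :
    ∃ c : ℝ, 0 < c ∧ ∀ᶠ n : ℕ in Filter.atTop,
      c * ((n : ℝ) ^ (-mu) * (if lam = δ then Real.log n else 1)) ≤
        ∫ φ in ((n : ℝ)⁻¹)..(π / 4), |Mosc lam mu δ n φ| * Real.sin φ ^ (2 * lam) := by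
  obtain ⟨c, C, hc, hC, h⟩ :=
    exists_integral_abs_Mosc_lower_bound lam mu δ hmu1 hmu2 hlam hδ1 hδ2
  set σ := lam + mu + δ / 2 + 1 / 2 with hσ
  have hσ0 : 0 < σ := by rw [hσ]; linarith
  have hpi := Real.pi_pos
  have hpow : ∀ n : ℕ, 1 ≤ n → (1 + σ) ^ (-mu) * (n : ℝ) ^ (-mu) ≤ ((n : ℝ) + σ) ^ (-mu) := by
    intro n hn
    have hn' : (1 : ℝ) ≤ n := by exact_mod_cast hn
    rw [← Real.mul_rpow (by linarith) (by linarith)]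
    exact Real.rpow_le_rpow_of_nonpos (by linarith) (by nlinarith) (by linarith)
  have hσ' : 0 < (1 + σ) ^ (-mu) := Real.rpow_pos_of_pos (by linarith) _
  by_cases hp : lam = δ
  · refine ⟨(1 + σ) ^ (-mu) * (c / 2), by positivity, ?_⟩
    have hlog : Filter.Tendsto (fun n : ℕ => Real.log (n : ℝ)) Filter.atTop Filter.atTop :=
      Real.tendsto_log_atTop.comp tendsto_natCast_atTop_atTop
    filter_upwards [Filter.eventually_ge_atTop 2,
      hlog.eventually_ge_atTop ((C * (π / 4) ^ (δ + 1) + C - c * Real.log (π / 4)) / (c / 2))]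
      with n hn hn2
    have hn' : (2 : ℝ) ≤ n := by exact_mod_cast hn
    have hn0 : (0 : ℝ) < n := by linarith
    have hle : (n : ℝ)⁻¹ ≤ π / 4 := by
      have : (n : ℝ)⁻¹ ≤ 2⁻¹ := inv_anti₀ (by norm_num) hn'
      linarith [Real.pi_gt_three]
    have hNx : 1 ≤ ((n : ℝ) + σ) * (n : ℝ)⁻¹ := by
      rw [← div_eq_mul_inv, one_le_div hn0]; linarith
    have h1 := h n _ _ _ rfl (inv_pos.2 hn0) hle le_rfl hNx
    refine le_trans ?_ h1
    rw [if_pos hp, show lam - δ = 0 by linarith, Real.rpow_zero, one_mul, div_inv_eq_mul,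
      Real.log_mul (by positivity) hn0.ne']
    rw [div_le_iff₀ (by positivity)] at hn2
    have h2 : C * (((n : ℝ) + σ) * (n : ℝ)⁻¹) ^ (mu - 1) ≤ C * 1 :=
      mul_le_mul_of_nonneg_left (Real.rpow_le_one_of_one_le_of_nonpos hNx (by linarith)) hC.le
    have hl : 0 ≤ Real.log n := Real.log_nonneg (by linarith)
    calc (1 + σ) ^ (-mu) * (c / 2) * ((n : ℝ) ^ (-mu) * Real.log n)
        = ((1 + σ) ^ (-mu) * (n : ℝ) ^ (-mu)) * (c / 2 * Real.log n) := by ring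
      _ ≤ ((n : ℝ) + σ) ^ (-mu) * (c / 2 * Real.log n) :=
          mul_le_mul_of_nonneg_right (hpow n (by omega)) (by positivity)
      _ ≤ _ := by
          refine mul_le_mul_of_nonneg_left ?_ (Real.rpow_nonneg (by linarith) _)
          linarith
  · have hl2 : 0 < Real.log 2 := Real.log_pos (by norm_num)
    have hη : 0 < c * Real.log 2 / (4 * C) := by positivity
    obtain ⟨y, hy0, hy1, hy2⟩ : ∃ y : ℝ, 0 < y ∧ y < π / 4 ∧
        y ^ (δ + 1) < c * Real.log 2 / (4 * C) := by
      have t1 : Filter.Tendsto (fun y : ℝ => y ^ (δ + 1)) (nhdsWithin 0 (Set.Ioi 0))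
          (nhds 0) := by
        have := (Real.continuousAt_rpow_const 0 (δ + 1) (Or.inr (by linarith))).tendsto
        rw [Real.zero_rpow (by linarith)] at this
        exact this.mono_left nhdsWithin_le_nhds
      obtain ⟨y, hy, hy'⟩ := ((t1.eventually_lt_const hη).and
        (Ioo_mem_nhdsGT (show (0 : ℝ) < π / 4 by positivity))).exists
      exact ⟨y, hy'.1, hy'.2, hy⟩
    have hx0 : 0 < y / 2 := by positivity
    have hxp : 0 < (y / 2) ^ (lam - δ) := Real.rpow_pos_of_pos hx0 _
    refine ⟨(1 + σ) ^ (-mu) * ((y / 2) ^ (lam - δ) * (c * Real.log 2 / 2)), by positivity, ?_⟩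
    have ht : Filter.Tendsto (fun n : ℕ => ((n : ℝ) + σ) * (y / 2)) Filter.atTop Filter.atTop :=
      (Filter.tendsto_atTop_add_const_right _ _ tendsto_natCast_atTop_atTop).atTop_mul_const hx0
    have ht2 : Filter.Tendsto (fun n : ℕ => (((n : ℝ) + σ) * (y / 2)) ^ (mu - 1)) Filter.atTop
        (nhds 0) := by
      have := (tendsto_rpow_neg_atTop (show 0 < 1 - mu by linarith)).comp ht
      rwa [neg_sub] at this
    filter_upwards [Filter.eventually_ge_atTop 1, ht.eventually_ge_atTop 1,
      ht2.eventually_lt_const hη,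
      tendsto_natCast_atTop_atTop.eventually_ge_atTop (y / 2)⁻¹] with n hn hn1 hn2 hn3
    have hn' : (1 : ℝ) ≤ n := by exact_mod_cast hn
    have hninv : (n : ℝ)⁻¹ ≤ y / 2 := inv_le_of_inv_le₀ hx0 hn3
    have hn0 : 0 < (n : ℝ)⁻¹ := by positivity
    have h1 := h n _ _ _ rfl hx0 (by linarith : y / 2 ≤ y) hy1.le hn1
    have hsub : ∫ φ in (y / 2)..y, |Mosc lam mu δ n φ| * Real.sin φ ^ (2 * lam) ≤
        ∫ φ in ((n : ℝ)⁻¹)..(π / 4), |Mosc lam mu δ n φ| * Real.sin φ ^ (2 * lam) := by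
      refine intervalIntegral.integral_mono_interval hninv (by linarith) hy1.le ?_
        (intervalIntegrable_abs_Mosc_mul lam δ hmu1 n hn0 (by linarith) le_rfl)
      filter_upwards [ae_restrict_mem measurableSet_Ioc] with t ht
      exact abs_Mosc_mul_nonneg lam mu δ n (by linarith [ht.1]) ht.2
    refine le_trans ?_ (h1.trans hsub)
    rw [if_neg hp, mul_one, show y / (y / 2) = 2 by field_simp]
    rw [lt_div_iff₀ (by positivity)] at hy2 hn2
    calc (1 + σ) ^ (-mu) * ((y / 2) ^ (lam - δ) * (c * Real.log 2 / 2)) * (n : ℝ) ^ (-mu)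
        = ((1 + σ) ^ (-mu) * (n : ℝ) ^ (-mu)) *
          ((y / 2) ^ (lam - δ) * (c * Real.log 2 / 2)) := by ring
      _ ≤ ((n : ℝ) + σ) ^ (-mu) * ((y / 2) ^ (lam - δ) * (c * Real.log 2 / 2)) :=
          mul_le_mul_of_nonneg_right (hpow n hn) (by positivity)
      _ ≤ _ := by
          refine mul_le_mul_of_nonneg_left (mul_le_mul_of_nonneg_left ?_ hxp.le)
            (Real.rpow_nonneg (by linarith) _)
          linarith

lemma exists_pos_forall_mul_le_of_eventually {A B : ℕ → ℝ} {k : ℕ}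
    (hA : ∀ n, k ≤ n → 0 < A n) (hB : ∀ n, k ≤ n → 0 < B n)
    (h : ∃ c : ℝ, 0 < c ∧ ∀ᶠ n in Filter.atTop, c * B n ≤ A n) :
    ∃ c : ℝ, 0 < c ∧ ∀ n, k ≤ n → c * B n ≤ A n := by
  obtain ⟨c, hc, h⟩ := h
  obtain ⟨m, hm⟩ := Filter.eventually_atTop.1 h
  have hfin : ∀ m : ℕ, ∃ c : ℝ, 0 < c ∧ ∀ n < m, k ≤ n → c * B n ≤ A n := by
    intro m
    induction m with
    | zero => exact ⟨1, one_pos, fun n hn => absurd hn (Nat.not_lt_zero n)⟩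
    | succ m ih =>
      obtain ⟨c, hc, ih⟩ := ih
      by_cases hk : k ≤ m
      · refine ⟨min c (A m / B m), lt_min hc (div_pos (hA m hk) (hB m hk)), fun n hn hkn => ?_⟩
        rcases Nat.lt_succ_iff_lt_or_eq.1 hn with h1 | rfl
        · exact (mul_le_mul_of_nonneg_right (min_le_left _ _) (hB n hkn).le).trans (ih n h1 hkn)
        · rw [← le_div_iff₀ (hB n hkn)]
          exact min_le_right _ _
      · exact ⟨c, hc, fun n hn hkn => absurd (hkn.trans (Nat.le_of_lt_succ hn)) hk⟩
  obtain ⟨c', hc', h'⟩ := hfin m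
  refine ⟨min c c', lt_min hc hc', fun n hkn => ?_⟩
  rcases lt_or_ge n m with h1 | h1
  · exact (mul_le_mul_of_nonneg_right (min_le_right _ _) (hB n hkn).le).trans (h' n h1 hkn)
  · exact (mul_le_mul_of_nonneg_right (min_le_left _ _) (hB n hkn).le).trans (hm n h1)

/-- Lemma 4.4: for `0 < μ < 1`, `λ ≥ 0`, `-1 < δ ≤ λ`, there is
`c > 0` such that for all `n ≥ 2`,
`∫_{1/n}^{π/4} |M_n(φ)| (sin φ)^{2λ} dφ ≥ c n^{-μ} L_n`, where `L_n = log n` if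
`λ = δ` and `L_n = 1` if `-1 < δ < λ`. -/
theorem lower_bound_Mosc_integral (lam mu δ : ℝ) (hmu1 : 0 < mu) (hmu2 : mu < 1)
    (hlam : 0 ≤ lam) (hδ1 : -1 < δ) (hδ2 : δ ≤ lam) :
    ∃ c : ℝ, 0 < c ∧ ∀ n : ℕ, 2 ≤ n →
      c * (n : ℝ) ^ (-mu) * (if lam = δ then Real.log n else 1) ≤
        ∫ φ in ((n : ℝ)⁻¹)..(Real.pi / 4), |Mosc lam mu δ n φ| * (Real.sin φ) ^ (2 * lam) := by
  have hpos : ∀ n : ℕ, 2 ≤ n →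
      0 < (n : ℝ) ^ (-mu) * (if lam = δ then Real.log n else 1) := by
    intro n hn
    have hn' : (2 : ℝ) ≤ n := by exact_mod_cast hn
    refine mul_pos (Real.rpow_pos_of_pos (by linarith) _) ?_
    split_ifs
    · exact Real.log_pos (by linarith)
    · exact one_pos
  obtain ⟨c, hc, h⟩ := exists_pos_forall_mul_le_of_eventually
    (fun n hn => integral_abs_Mosc_mul_pos (mu := mu) hmu1 hlam hδ1 hn) hpos
    (eventually_integral_abs_Mosc_lower_bound lam mu δ hmu1 hmu2 hlam hδ1 hδ2)
  refine ⟨c, hc, fun n hn => ?_⟩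
  rw [mul_assoc]
  exact h n hn
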